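/- arXiv:0707.4339 — 2 statements merged into one kernel-verified Lean document; each statement's English description precedes it below -/
import Mathlib

section
/- Let G be a finite group and K its Schur multiplier H₂(G, ℤ), and let e be the exponent of K. Then e² divides |G|. -/
open Subgroup

/-- The Schur multiplier `H₂(G, ℤ)` of a group `G`, defined via Hopf's formula
`H₂(G, ℤ) ≅ (R ∩ [F, F]) / [F, R]` for the free presentation `1 → R → F → G → 1`
with `F` the free group on (the underlying set of) `G` and `F → G` the canonical
surjection. -/
def SchurMultiplier (G : Type*) [Group G] : Type _ :=
  let F := FreeGroup G
  let R : Subgroup F := (FreeGroup.lift (id : G → G)).ker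
  ↥(R ⊓ commutator F) ⧸ ((⁅(⊤ : Subgroup F), R⁆).subgroupOf (R ⊓ commutator F))

noncomputable instance (G : Type*) [Group G] : Group (SchurMultiplier G) := by
  unfold SchurMultiplier; infer_instance

namespace SchurAux

/-- A multiplicative extension of a partial character to a cyclic overgroup. -/
theorem exists_ext {E T : Type*} [Group E] [CommGroup T] (p : ℕ) [hp : Fact p.Prime]
    (Z M : Subgroup E) (f : E → T)
    (hf : ∀ a ∈ Z, ∀ b ∈ Z, f (a * b) = f a * f b)
    (hn : ∀ m ∈ M, ∀ z ∈ Z, m * z * m⁻¹ ∈ Z)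
    (hi : ∀ m ∈ M, ∀ z ∈ Z, f (m * z * m⁻¹) = f z)
    (x : E) (hxM : x ∈ M) (hxZ : x ∉ Z) (hxp : x ^ p ∈ Z) (t : T) (ht : t ^ p = f (x ^ p)) :
    ∃ (Z' : Subgroup E) (g : E → T), Z ≤ Z' ∧ x ∈ Z' ∧
      (∀ y ∈ Z', ∃ z ∈ Z, ∃ i : ℤ, y = z * x ^ i) ∧
      (∀ z ∈ Z, ∀ i : ℤ, g (z * x ^ i) = f z * t ^ i) ∧
      (∀ a ∈ Z', ∀ b ∈ Z', g (a * b) = g a * g b) := by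
  have hf1 : f 1 = 1 := by
    have := hf 1 Z.one_mem 1 Z.one_mem
    simpa using this
  have hfinv : ∀ a ∈ Z, f a⁻¹ = (f a)⁻¹ := by
    intro a ha
    have := hf a ha a⁻¹ (Z.inv_mem ha)
    rw [mul_inv_cancel, hf1] at this
    exact (inv_eq_of_mul_eq_one_right this.symm).symm
  let fh : Z →* T := ⟨⟨fun a => f a, hf1⟩, fun a b => hf a a.2 b b.2⟩
  have hpow : ∀ k : ℤ, x ^ ((p : ℤ) * k) ∈ Z ∧ f (x ^ ((p : ℤ) * k)) = t ^ ((p : ℤ) * k) := by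
    intro k
    have h1 : x ^ ((p : ℤ) * k) = ((⟨x ^ p, hxp⟩ : Z) ^ k : Z) := by
      simp [zpow_mul]
    refine ⟨by rw [h1]; exact Subtype.prop _, ?_⟩
    rw [h1]
    change fh _ = _
    rw [map_zpow, zpow_mul, zpow_natCast, ht]
    rfl
  have hdvd : ∀ i : ℤ, x ^ i ∈ Z → (p : ℤ) ∣ i := by
    intro i hi'
    by_contra hnd
    have hcop : IsCoprime (p : ℤ) i :=
      (Prime.coprime_iff_not_dvd (Nat.prime_iff_prime_int.mp hp.out)).2 hnd
    obtain ⟨a, b, hab⟩ := hcop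
    apply hxZ
    have : x = x ^ ((p : ℤ) * a) * (x ^ i) ^ b := by
      rw [← zpow_mul, ← zpow_add]
      conv_lhs => rw [← zpow_one x]
      congr 1
      rw [← hab]; ring
    rw [this]
    exact Z.mul_mem (hpow a).1 (Z.zpow_mem hi' b)
  have hwd : ∀ z ∈ Z, ∀ z' ∈ Z, ∀ i j : ℤ, z * x ^ i = z' * x ^ j →
      f z * t ^ i = f z' * t ^ j := by
    intro z hz z' hz' i j h
    have h2 : x ^ (i - j) = z⁻¹ * z' := by
      rw [zpow_sub, eq_inv_mul_iff_mul_eq, ← mul_assoc, h]; group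
    have h3 : x ^ (i - j) ∈ Z := by rw [h2]; exact Z.mul_mem (Z.inv_mem hz) hz'
    obtain ⟨k, hk⟩ := hdvd _ h3
    have h4 := (hpow k).2
    rw [← hk, h2, hf _ (Z.inv_mem hz) _ hz', hfinv _ hz, zpow_sub] at h4
    rw [inv_mul_eq_iff_eq_mul] at h4
    rw [h4]
    simp [mul_assoc]
  classical
  let g : E → T := fun y =>
    if h : ∃ q : E × ℤ, q.1 ∈ Z ∧ y = q.1 * x ^ q.2 then f h.choose.1 * t ^ h.choose.2 else 1
  have hg : ∀ z ∈ Z, ∀ i : ℤ, g (z * x ^ i) = f z * t ^ i := by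
    intro z hz i
    have h : ∃ q : E × ℤ, q.1 ∈ Z ∧ z * x ^ i = q.1 * x ^ q.2 := ⟨(z, i), hz, rfl⟩
    have : g (z * x ^ i) = f h.choose.1 * t ^ h.choose.2 := dif_pos h
    rw [this]
    exact (hwd _ hz _ h.choose_spec.1 _ _ h.choose_spec.2).symm
  have hmul : ∀ (z z' : E) (i j : ℤ), (z * x ^ i) * (z' * x ^ j) =
      (z * (x ^ i * z' * (x ^ i)⁻¹)) * x ^ (i + j) := by
    intro z z' i j
    rw [zpow_add]; group
  have hc : ∀ z ∈ Z, ∀ i : ℤ, x ^ i * z * (x ^ i)⁻¹ ∈ Z := fun z hz i =>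
    hn _ (M.zpow_mem hxM i) z hz
  let Z' : Subgroup E :=
    { carrier := {y | ∃ z ∈ Z, ∃ i : ℤ, y = z * x ^ i}
      one_mem' := ⟨1, Z.one_mem, 0, by simp⟩
      mul_mem' := by
        rintro _ _ ⟨z, hz, i, rfl⟩ ⟨z', hz', j, rfl⟩
        exact ⟨_, Z.mul_mem hz (hc z' hz' i), _, hmul _ _ _ _⟩
      inv_mem' := by
        rintro _ ⟨z, hz, i, rfl⟩
        refine ⟨_, hc _ (Z.inv_mem hz) (-i), -i, ?_⟩
        group }
  refine ⟨Z', g, ?_, ?_, fun y hy => hy, hg, ?_⟩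
  · intro z hz
    exact ⟨z, hz, 0, by simp⟩
  · exact ⟨1, Z.one_mem, 1, by simp⟩
  · rintro _ ⟨z, hz, i, rfl⟩ _ ⟨z', hz', j, rfl⟩
    rw [hmul, hg _ (Z.mul_mem hz (hc z' hz' i)), hg _ hz, hg _ hz', hf _ hz _ (hc z' hz' i),
      hi _ (M.zpow_mem hxM i) _ hz', zpow_add]
    simp only [mul_assoc, mul_left_comm]

theorem exists_central {E : Type*} [Group E] (p : ℕ) [hp : Fact p.Prime]
    (Z M : Subgroup E) (hn : ∀ m ∈ M, ∀ z ∈ Z, m * z * m⁻¹ ∈ Z) (k : ℕ)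
    (hk : Z.relIndex M = p ^ (k + 1)) :
    ∃ x ∈ M, x ∉ Z ∧ x ^ p ∈ Z ∧ ∀ m ∈ M, m * x * m⁻¹ * x⁻¹ ∈ Z := by
  have hN : (Z.subgroupOf M).Normal := ⟨fun z hz m => by
    rw [Subgroup.mem_subgroupOf] at hz ⊢
    exact hn m m.2 z hz⟩
  let Q := M ⧸ Z.subgroupOf M
  have hcard : Nat.card Q = p ^ (k + 1) := hk
  have hfin : Finite Q := Nat.finite_of_card_ne_zero (by
    rw [hcard]; exact pow_ne_zero _ hp.out.ne_zero)
  have hQ : IsPGroup p Q := IsPGroup.of_card hcard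
  have hnt : Nontrivial Q := by
    rw [← Finite.one_lt_card_iff_nontrivial, hcard]
    exact Nat.one_lt_pow (by omega) hp.out.one_lt
  have hcn : Nontrivial (Subgroup.center Q) := hQ.center_nontrivial
  obtain ⟨n, hn0, hcc⟩ := (hQ.to_subgroup (Subgroup.center Q)).nontrivial_iff_card.1 hcn
  obtain ⟨y, hy⟩ := exists_prime_orderOf_dvd_card' (G := Subgroup.center Q) p
    (by rw [hcc]; exact dvd_pow_self _ (by omega))
  obtain ⟨x, hx⟩ := QuotientGroup.mk_surjective (y : Q)
  have hy1 : (y : Q) ≠ 1 := by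
    intro h
    have : y = 1 := Subtype.ext h
    rw [this, orderOf_one] at hy
    exact hp.out.one_lt.ne hy
  refine ⟨x, x.2, ?_, ?_, ?_⟩
  · intro hxZ
    apply hy1
    rw [← hx, QuotientGroup.eq_one_iff, Subgroup.mem_subgroupOf]
    exact hxZ
  · have : ((x ^ p : M) : Q) = 1 := by
      rw [QuotientGroup.mk_pow, hx, ← hy]
      exact congrArg Subtype.val (pow_orderOf_eq_one y)
    rw [QuotientGroup.eq_one_iff, Subgroup.mem_subgroupOf] at this
    exact this
  · intro m hm
    have : (((⟨m, hm⟩ : M) * x * (⟨m, hm⟩ : M)⁻¹ * x⁻¹ : M) : Q) = 1 := by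
      simp only [QuotientGroup.mk_mul, QuotientGroup.mk_inv, hx]
      rw [Subgroup.mem_center_iff.1 y.2]
      group
    rw [QuotientGroup.eq_one_iff, Subgroup.mem_subgroupOf] at this
    exact this

theorem exists_polarization {E T : Type*} [Group E] [CommGroup T] (p : ℕ) [hp : Fact p.Prime]
    (hdiv : ∀ t : T, ∃ s : T, s ^ p = t)
    (htors : ∀ S : Subgroup T, (∀ s ∈ S, s ^ p = 1) → Nat.card S ≤ p) (n : ℕ) :
    ∀ (k : ℕ), k ≤ n → ∀ (Z M : Subgroup E) (f : E → T), Z ≤ M →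
    (∀ a ∈ Z, ∀ b ∈ Z, f (a * b) = f a * f b) →
    (∀ m ∈ M, ∀ z ∈ Z, m * z * m⁻¹ ∈ Z) →
    (∀ m ∈ M, ∀ z ∈ Z, f (m * z * m⁻¹) = f z) → Z.relIndex M = p ^ k →
    ∃ (H : Subgroup E) (g : E → T), Z ≤ H ∧ H ≤ M ∧
      (∀ a ∈ H, ∀ b ∈ H, g (a * b) = g a * g b) ∧ (∀ z ∈ Z, g z = f z) ∧
      H.relIndex M ^ 2 ∣ Z.relIndex M := by
  induction n with
  | zero =>
    intro k hk Z M f hZM hf hn hi hidx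
    obtain rfl : k = 0 := by omega
    refine ⟨Z, f, le_rfl, hZM, hf, fun _ _ => rfl, ?_⟩
    rw [hidx]; simp
  | succ n ih =>
    intro k hk Z M f hZM hf hn hi hidx
    rcases Nat.eq_zero_or_pos k with rfl | hkpos
    · refine ⟨Z, f, le_rfl, hZM, hf, fun _ _ => rfl, ?_⟩
      rw [hidx]; simp
    obtain ⟨k, rfl⟩ : ∃ l, k = l + 1 := ⟨k - 1, by omega⟩
    obtain ⟨x, hxM, hxZ, hxp, hxc⟩ := exists_central p Z M hn k hidx
    obtain ⟨t, ht⟩ := hdiv (f (x ^ p))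
    obtain ⟨Z', g, hZZ', hxZ', hrep, hg, hgm⟩ :=
      exists_ext p Z M f hf hn hi x hxM hxZ hxp t ht
    have hf1 : f 1 = 1 := by
      have := hf 1 Z.one_mem 1 Z.one_mem
      simpa using this
    have hfinv : ∀ a ∈ Z, f a⁻¹ = (f a)⁻¹ := by
      intro a ha
      have := hf a ha a⁻¹ (Z.inv_mem ha)
      rw [mul_inv_cancel, hf1] at this
      exact (inv_eq_of_mul_eq_one_right this.symm).symm
    have hgZ : ∀ z ∈ Z, g z = f z := by
      intro z hz
      simpa using hg z hz 0
    have hgx : g x = t := by simpa [hf1] using hg 1 Z.one_mem 1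
    have hgpow : ∀ y ∈ Z', ∀ j : ℕ, g (y ^ j) = g y ^ j := by
      intro y hy j
      induction j with
      | zero => simp [hgZ 1 Z.one_mem, hf1]
      | succ j ihj => rw [pow_succ, hgm _ (Z'.pow_mem hy j) _ hy, ihj, pow_succ]
    -- the commutator character
    let c : M →* T :=
      MonoidHom.mk' (fun m => f (m * x * (m : E)⁻¹ * x⁻¹)) (by
        intro a b
        have h1 : ((a * b : M) : E) * x * ((a * b : M) : E)⁻¹ * x⁻¹ =
            (a * (b * x * (b : E)⁻¹ * x⁻¹) * (a : E)⁻¹) * (a * x * (a : E)⁻¹ * x⁻¹) := by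
          push_cast; group
        show f _ = f _ * f _
        rw [h1, hf _ (hn _ a.2 _ (hxc _ b.2)) _ (hxc _ a.2), hi _ a.2 _ (hxc _ b.2), mul_comm])
    have hcdef : ∀ m : M, c m = f (m * x * (m : E)⁻¹ * x⁻¹) := fun m => rfl
    have hcp : ∀ m : M, c m ^ p = 1 := by
      intro m
      have hu := hxc m m.2
      have h1 : (m : E) * x * (m : E)⁻¹ = (m * x * (m : E)⁻¹ * x⁻¹) * x := by group
      have h2 : g (((m : E) * x * (m : E)⁻¹) ^ p) = t ^ p := by
        rw [conj_pow, hgZ _ (hn _ m.2 _ hxp), hi _ m.2 _ hxp, ht]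
      rw [h1, hgpow _ (Z'.mul_mem (hZZ' hu) hxZ'), hgm _ (hZZ' hu) _ hxZ', hgZ _ hu, hgx,
        mul_pow] at h2
      rw [hcdef]
      exact mul_eq_right.1 h2
    let M' : Subgroup E := c.ker.map M.subtype
    have hM' : ∀ m, m ∈ M' ↔ m ∈ M ∧ f (m * x * m⁻¹ * x⁻¹) = 1 := by
      intro m
      constructor
      · rintro ⟨y, hy, rfl⟩
        exact ⟨y.2, hy⟩
      · rintro ⟨h1, h2⟩
        exact ⟨⟨m, h1⟩, h2, rfl⟩
    have hM'M : M' ≤ M := fun m hm => ((hM' m).1 hm).1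
    have hidxM' : M'.relIndex M ≤ p := by
      have : M'.relIndex M = Nat.card c.range := by
        rw [← Subgroup.index_ker]
        show (M'.subgroupOf M).index = _
        congr 1
        exact Subgroup.comap_map_eq_self_of_injective M.subtype_injective _
      rw [this]
      apply htors
      rintro _ ⟨m, rfl⟩
      exact hcp m
    have hxM' : x ∈ M' := (hM' x).2 ⟨hxM, by simp [hf1]⟩
    have hZM' : Z ≤ M' := by
      intro z hz
      refine (hM' z).2 ⟨hZM hz, ?_⟩
      have h1 : z * x * z⁻¹ * x⁻¹ = z * (x * z⁻¹ * x⁻¹) := by group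
      rw [h1, hf _ hz _ (hn _ hxM _ (Z.inv_mem hz)), hi _ hxM _ (Z.inv_mem hz), hfinv _ hz]
      simp
    have hZ'M' : Z' ≤ M' := by
      intro y hy
      obtain ⟨z, hz, i, rfl⟩ := hrep y hy
      exact M'.mul_mem (hZM' hz) (M'.zpow_mem hxM' i)
    have hconjx : ∀ m ∈ M, m * x * m⁻¹ ∈ Z' := by
      intro m hm
      have h1 : m * x * m⁻¹ = (m * x * m⁻¹ * x⁻¹) * x := by group
      rw [h1]
      exact Z'.mul_mem (hZZ' (hxc m hm)) hxZ'
    have hn' : ∀ m ∈ M', ∀ z ∈ Z', m * z * m⁻¹ ∈ Z' := by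
      intro m hm y hy
      obtain ⟨z, hz, i, rfl⟩ := hrep y hy
      rw [← conj_mul, ← conj_zpow]
      exact Z'.mul_mem (hZZ' (hn _ (hM'M hm) _ hz)) (Z'.zpow_mem (hconjx m (hM'M hm)) i)
    let gh : Z' →* T := MonoidHom.mk' (fun a => g a) (fun a b => hgm a a.2 b b.2)
    have hgz : ∀ y ∈ Z', ∀ i : ℤ, g (y ^ i) = g y ^ i := by
      intro y hy i
      exact map_zpow gh ⟨y, hy⟩ i
    have hi' : ∀ m ∈ M', ∀ z ∈ Z', g (m * z * m⁻¹) = g z := by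
      intro m hm y hy
      obtain ⟨z, hz, i, rfl⟩ := hrep y hy
      have hmM := hM'M hm
      have h1 : m * x * m⁻¹ = (m * x * m⁻¹ * x⁻¹) * x := by group
      have h2 : g (m * x * m⁻¹) = t := by
        rw [h1, hgm _ (hZZ' (hxc m hmM)) _ hxZ', hgZ _ (hxc m hmM), ((hM' m).1 hm).2, hgx, one_mul]
      rw [← conj_mul, ← conj_zpow, hgm _ (hZZ' (hn _ hmM _ hz)) _ (Z'.zpow_mem (hconjx m hmM) i),
        hgz _ (hconjx m hmM), h2, hgZ _ (hn _ hmM _ hz), hi _ hmM _ hz, hg _ hz]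
    have e1 : Z.relIndex Z' * Z'.relIndex M = Z.relIndex M :=
      Subgroup.relIndex_mul_relIndex _ _ _ hZZ' (hZ'M'.trans hM'M)
    have e2 : Z'.relIndex M' * M'.relIndex M = Z'.relIndex M :=
      Subgroup.relIndex_mul_relIndex _ _ _ hZ'M' hM'M
    have hpp := hp.out
    obtain ⟨a, -, ha⟩ := (Nat.dvd_prime_pow hpp).1 (hidx ▸ Dvd.intro _ e1)
    obtain ⟨b, -, hb⟩ := (Nat.dvd_prime_pow hpp).1
      (hidx ▸ e1 ▸ e2 ▸ Dvd.intro_left _ (mul_assoc _ _ _) : M'.relIndex M ∣ p ^ (k + 1))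
    obtain ⟨d, -, hd⟩ := (Nat.dvd_prime_pow hpp).1
      (hidx ▸ e1 ▸ e2 ▸ (Dvd.intro _ rfl).mul_left _ :
        Z'.relIndex M' ∣ p ^ (k + 1))
    have ha1 : a ≠ 0 := by
      rintro rfl
      rw [pow_zero, Subgroup.relIndex_eq_one] at ha
      exact hxZ (ha hxZ')
    have hb1 : b ≤ 1 := by
      rw [hb] at hidxM'
      exact (Nat.pow_le_pow_iff_right hpp.one_lt).1 (by simpa using hidxM')
    have hsum : a + (d + b) = k + 1 := by
      rw [← e2, ha, hb, hd, hidx, ← pow_add, ← pow_add] at e1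
      exact Nat.pow_right_injective hpp.two_le e1
    obtain ⟨H, g', h1, h2, h3, h4, h5⟩ := ih d (by omega) Z' M' g hZ'M' hgm hn' hi' hd
    refine ⟨H, g', hZZ'.trans h1, h2.trans hM'M, h3, fun z hz => ?_, ?_⟩
    · rw [h4 z (hZZ' hz), hgZ z hz]
    · rw [← Subgroup.relIndex_mul_relIndex H M' M h2 hM'M, mul_pow, hidx, ← hsum, hb]
      rw [hd] at h5
      calc _ ∣ p ^ d * (p ^ b) ^ 2 := Nat.mul_dvd_mul_right h5 _
        _ = p ^ (d + b + b) := by ring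
        _ ∣ _ := pow_dvd_pow _ (by omega)

/-- The divisible target group `ℚ/ℤ`, written multiplicatively. -/
abbrev QZ : Type := Multiplicative (AddCircle (1 : ℚ))

theorem qz_div (p : ℕ) (hp : p ≠ 0) (t : QZ) : ∃ s : QZ, s ^ p = t := by
  refine ⟨Multiplicative.ofAdd (DivisibleBy.div t.toAdd (p : ℤ)), ?_⟩
  apply Multiplicative.toAdd.injective
  have := DivisibleBy.div_cancel (α := ℤ) t.toAdd (n := (p : ℤ)) (by exact_mod_cast hp)
  rw [toAdd_pow, toAdd_ofAdd]
  rw [natCast_zsmul] at this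
  exact this

theorem qz_tors (p : ℕ) (hp : p ≠ 0) (S : Subgroup QZ) (hS : ∀ s ∈ S, s ^ p = 1) :
    Nat.card S ≤ p := by
  have : Fact ((0 : ℚ) < 1) := ⟨one_pos⟩
  have key : ∀ s : S, ∃ m : Fin p,
      ((((m : ℕ) : ℚ) / (p : ℚ) * 1 : ℚ) : AddCircle (1 : ℚ)) = (s : QZ).toAdd := by
    intro s
    have h : p • (s : QZ).toAdd = 0 := congrArg Multiplicative.toAdd (hS s s.2)
    obtain ⟨m, hm, h'⟩ := (AddCircle.nsmul_eq_zero_iff (Nat.pos_of_ne_zero hp)).1 h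
    exact ⟨⟨m, hm⟩, h'⟩
  choose F hF using key
  have hinj : Function.Injective F := by
    intro a b hab
    have := hF a
    rw [hab, hF b] at this
    exact Subtype.ext (Multiplicative.toAdd.injective this.symm)
  simpa using Nat.card_le_card_of_injective F hinj

theorem exists_char {A : Type*} [CommGroup A] (a : A) (ha : a ≠ 1) :
    ∃ c : A →* QZ, c a ≠ 1 := by
  obtain ⟨c, hc⟩ := CharacterModule.exists_character_apply_ne_zero_of_ne_zero
    (A := Additive A) (a := Additive.ofMul a) ha
  let c' : Additive A →+ AddCircle (1 : ℚ) := c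
  exact ⟨AddMonoidHom.toMultiplicativeRight c', hc⟩

theorem transfer_pow {E T : Type*} [Group E] [CommGroup T] (H : Subgroup E) [H.FiniteIndex]
    (φ : H →* T) (z : E) (hz : z ∈ Subgroup.center E) (hzc : z ∈ commutator E) (hzH : z ∈ H) :
    φ ⟨z, hzH⟩ ^ H.index = 1 := by
  have h1 := MonoidHom.transfer_eq_pow φ z (by
    intro k g _
    rw [Subgroup.mem_center_iff.1 ((Subgroup.center E).pow_mem hz k) g⁻¹, inv_mul_cancel_right])
  have h2 : φ.transfer z = 1 :=
    MonoidHom.mem_ker.1 (Abelianization.commutator_subset_ker φ.transfer hzc)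
  rw [h2] at h1
  rw [h1, ← map_pow]
  rfl

theorem main_aux {E : Type*} [Group E] (Z : Subgroup E) (hZ : Z ≤ Subgroup.center E)
    (hfi : Z.index ≠ 0) (p a : ℕ) [hp : Fact p.Prime] (z : E) (hz : z ∈ Z)
    (hzc : z ∈ commutator E) (ho : orderOf z = p ^ a) : (p ^ a) ^ 2 ∣ Z.index := by
  rcases Nat.eq_zero_or_pos a with rfl | ha
  · simp
  obtain ⟨a, rfl⟩ : ∃ l, a = l + 1 := ⟨a - 1, by omega⟩
  have hpp := hp.out
  have hcomm : ∀ z ∈ Z, ∀ m : E, m * z * m⁻¹ = z := by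
    intro z hz m
    rw [Subgroup.mem_center_iff.1 (hZ hz) m]; simp
  have hZn : Z.Normal := ⟨fun y hy m => by rw [hcomm y hy m]; exact hy⟩
  let _ : CommGroup Z :=
    { (inferInstance : Group Z) with
      mul_comm := fun x y => Subtype.ext (Subgroup.mem_center_iff.1 (hZ y.2) x) }
  -- the character
  obtain ⟨χ, hχ⟩ := exists_char ((⟨z, hz⟩ : Z) ^ p ^ a) (by
    intro h
    have h' : z ^ p ^ a = 1 := congrArg Subtype.val h
    have := orderOf_dvd_of_pow_eq_one h'
    rw [ho, Nat.pow_dvd_pow_iff_le_right hpp.one_lt] at this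
    omega)
  have hχo : orderOf (χ ⟨z, hz⟩) = p ^ (a + 1) := by
    apply orderOf_eq_prime_pow
    · rwa [← map_pow]
    · rw [← map_pow]
      have : (⟨z, hz⟩ : Z) ^ p ^ (a + 1) = 1 := by
        apply Subtype.ext
        show z ^ p ^ (a + 1) = 1
        rw [← ho, pow_orderOf_eq_one]
      rw [this, map_one]
  classical
  let f : E → QZ := fun e => if h : e ∈ Z then χ ⟨e, h⟩ else 1
  have hfZ : ∀ e (h : e ∈ Z), f e = χ ⟨e, h⟩ := fun e h => dif_pos h
  -- Sylow subgroup
  have hfinQ : Finite (E ⧸ Z) := Nat.finite_of_card_ne_zero hfi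
  obtain ⟨P⟩ : Nonempty (Sylow p (E ⧸ Z)) := inferInstance
  let M : Subgroup E := P.1.comap (QuotientGroup.mk' Z)
  have hZM : Z ≤ M := by
    intro y hy
    show QuotientGroup.mk' Z y ∈ P.1
    rw [(QuotientGroup.eq_one_iff y).2 hy |> (fun h => (h : QuotientGroup.mk' Z y = 1))]
    exact P.1.one_mem
  have hMidx : M.index = P.1.index :=
    Subgroup.index_comap_of_surjective _ (QuotientGroup.mk'_surjective Z)
  have hMnd : ¬ p ∣ M.index := by
    rw [hMidx]; exact P.not_dvd_index
  have hrel : Z.relIndex M * M.index = Z.index := Subgroup.relIndex_mul_index hZM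
  have hrelc : Z.relIndex M = p ^ (Nat.card (E ⧸ Z)).factorization p := by
    rw [← P.card_eq_multiplicity]
    have h1 : Nat.card P.1 * P.1.index = Nat.card (E ⧸ Z) := P.1.card_mul_index
    have h2 : Z.relIndex M * P.1.index = Nat.card P.1 * P.1.index := by
      rw [h1, ← hMidx, hrel]; rfl
    exact Nat.eq_of_mul_eq_mul_right (Nat.pos_of_ne_zero Subgroup.FiniteIndex.index_ne_zero) h2
  obtain ⟨H, g, hZH, hHM, hgm, hgZ, hdvd⟩ := exists_polarization (E := E) (T := QZ) p
    (qz_div p hpp.ne_zero) (qz_tors p hpp.ne_zero) _ _ le_rfl Z M f hZM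
    (by
      intro x hx y hy
      rw [hfZ _ hx, hfZ _ hy, hfZ _ (Z.mul_mem hx hy), ← map_mul]; rfl)
    (by
      intro m _ y hy
      rw [hcomm y hy]; exact hy)
    (by
      intro m _ y hy
      rw [hcomm y hy]) hrelc
  have hHfi : H.FiniteIndex := ⟨fun h => hfi (by
    rw [← Subgroup.relIndex_mul_index hZH, h, mul_zero])⟩
  let φ : H →* QZ := MonoidHom.mk' (fun y => g y) (fun x y => hgm x x.2 y y.2)
  have ht := transfer_pow H φ z (hZ hz) hzc (hZH hz)
  have hφ : φ ⟨z, hZH hz⟩ = χ ⟨z, hz⟩ := (hgZ z hz).trans (hfZ z hz)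
  rw [hφ] at ht
  have hd := orderOf_dvd_of_pow_eq_one ht
  rw [hχo, ← Subgroup.relIndex_mul_index hHM] at hd
  have hcop : Nat.Coprime (p ^ (a + 1)) M.index :=
    Nat.Coprime.pow_left _ ((Nat.Prime.coprime_iff_not_dvd hpp).2 hMnd)
  have hd' := hcop.dvd_of_dvd_mul_right hd
  exact (pow_dvd_pow_of_dvd hd' 2).trans (hdvd.trans (Dvd.intro _ hrel))

theorem main_exp {E K : Type*} [Group E] [Group K] (Z : Subgroup E) (hZ : Z ≤ Subgroup.center E)
    (hfi : Z.index ≠ 0) (j : K →* E) (hj : Function.Injective j)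
    (hjZ : ∀ k, j k ∈ Z) (hjc : ∀ k, j k ∈ commutator E) :
    Monoid.exponent K ^ 2 ∣ Z.index := by
  have hexp : Monoid.exponent K ≠ 0 := by
    have : Monoid.exponent K ∣ Z.index := by
      apply Monoid.exponent_dvd_of_forall_pow_eq_one
      intro k
      let _ : CommGroup Z :=
        { (inferInstance : Group Z) with
          mul_comm := fun x y => Subtype.ext (Subgroup.mem_center_iff.1 (hZ y.2) x) }
      have : Z.FiniteIndex := ⟨hfi⟩
      have := transfer_pow Z (MonoidHom.id Z) (j k) (hZ (hjZ k)) (hjc k) (hjZ k)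
      have h2 : j k ^ Z.index = 1 := congrArg Subtype.val this
      apply hj
      rw [map_pow, h2, map_one]
    exact fun h => hfi (by simpa [h] using this)
  rw [← Nat.factorization_prime_le_iff_dvd (pow_ne_zero _ hexp) hfi]
  intro p hp
  have : Fact p.Prime := ⟨hp⟩
  obtain ⟨k, hk⟩ := hp.exists_orderOf_eq_pow_factorization_exponent K
  have := main_aux Z hZ hfi p _ (j k) (hjZ k) (hjc k) ((orderOf_injective j hj k).trans hk)
  rw [← pow_mul, hp.pow_dvd_iff_le_factorization hfi] at this
  rw [Nat.factorization_pow]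
  simpa [mul_comm] using this

end SchurAux

/-- If `G` is a finite group, `K = H₂(G, ℤ)` its Schur multiplier and `e` the exponent
of `K` (the least positive integer with `e • K = 0`), then `e²` divides `|G|`. -/
theorem schurMultiplier_exponent_sq_dvd_card (G : Type*) [Group G] [Finite G] :
    Monoid.exponent (SchurMultiplier G) ^ 2 ∣ Nat.card G := by
  let π : FreeGroup G →* G := FreeGroup.lift (id : G → G)
  let R : Subgroup (FreeGroup G) := π.ker
  let N : Subgroup (FreeGroup G) := ⁅(⊤ : Subgroup (FreeGroup G)), R⁆
  have hπ : Function.Surjective π := fun g => ⟨FreeGroup.of g, by simp [π]⟩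
  have hNR : N ≤ R := Subgroup.commutator_le_right _ _
  let q : FreeGroup G →* FreeGroup G ⧸ N := QuotientGroup.mk' N
  have hq : Function.Surjective q := QuotientGroup.mk'_surjective N
  have hqk : q.ker = N := QuotientGroup.ker_mk' N
  let Z : Subgroup (FreeGroup G ⧸ N) := R.map q
  have hidx : Z.index = Nat.card G := by
    have h1 : Z.index = R.index := Subgroup.index_map_eq R hq (by rw [hqk]; exact hNR)
    rw [h1, Subgroup.index_ker, MonoidHom.range_eq_top.2 hπ]
    exact Nat.card_congr Subgroup.topEquiv.toEquiv
  have hZ : Z ≤ Subgroup.center _ := by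
    rintro _ ⟨r, hr, rfl⟩
    rw [Subgroup.mem_center_iff]
    intro y
    obtain ⟨y, rfl⟩ := hq y
    have : q (y * r * y⁻¹ * r⁻¹) = 1 := by
      rw [← MonoidHom.mem_ker, hqk]
      exact Subgroup.commutator_mem_commutator (Subgroup.mem_top y) hr
    rw [map_mul, map_mul, map_mul, map_inv, map_inv, mul_inv_eq_one, mul_inv_eq_iff_eq_mul] at this
    exact this
  let S : Subgroup (FreeGroup G) := R ⊓ commutator (FreeGroup G)
  let j : SchurMultiplier G →* FreeGroup G ⧸ N :=
    QuotientGroup.lift (N.subgroupOf S) (q.comp S.subtype) (by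
      intro s hs
      rw [← hqk] at hs
      exact hs)
  have hjmk : ∀ s : S, j (QuotientGroup.mk (s := N.subgroupOf S) s) = q s := fun s => rfl
  have hsurj : ∀ k : SchurMultiplier G, ∃ s : S, QuotientGroup.mk (s := N.subgroupOf S) s = k :=
    QuotientGroup.mk_surjective
  have hj : Function.Injective j := by
    rw [injective_iff_map_eq_one]
    intro k hk
    obtain ⟨s, rfl⟩ := hsurj k
    rw [hjmk, ← MonoidHom.mem_ker, hqk] at hk
    exact (QuotientGroup.eq_one_iff s).2 hk
  rw [← hidx]
  refine SchurAux.main_exp Z hZ (by rw [hidx]; exact Nat.card_pos.ne') j hj ?_ ?_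
  · intro k
    obtain ⟨s, rfl⟩ := hsurj k
    exact ⟨s, s.2.1, rfl⟩
  · intro k
    obtain ⟨s, rfl⟩ := hsurj k
    rw [hjmk]
    have h1 : q s ∈ (commutator (FreeGroup G)).map q := ⟨s, s.2.2, rfl⟩
    rw [commutator_def, Subgroup.map_commutator] at h1
    rw [commutator_def]
    exact Subgroup.commutator_mono le_top le_top h1
end

section
/- Let X ⊆ ℙⁿ be a projective variety and G ⊆ PGL(n+1, ℂ) a finite group acting freely on X. Then |G| divides (deg X)². -/
open MvPolynomial

noncomputable section

variable (n : ℕ)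

/-- Points of complex projective `n`-space `ℙⁿ`. -/
abbrev Pn (n : ℕ) := Projectivization ℂ (Fin (n + 1) → ℂ)

/-- `GL(n+1, ℂ)`, realized as the group of `ℂ`-linear automorphisms of `ℂ^{n+1}`. -/
abbrev GLn (n : ℕ) := (Fin (n + 1) → ℂ) ≃ₗ[ℂ] (Fin (n + 1) → ℂ)

/-- `PGL(n+1, ℂ) = GL(n+1, ℂ)/center`. -/
abbrev PGLn (n : ℕ) := GLn n ⧸ Subgroup.center (GLn n)

/-- The affine cone (minus the origin) over a subset `X ⊆ ℙⁿ`. -/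
def cone (X : Set (Pn n)) : Set (Fin (n + 1) → ℂ) :=
  {v | ∃ hv : v ≠ 0, Projectivization.mk ℂ v hv ∈ X}

/-- `X ⊆ ℙⁿ` is a projective variety: it is the common zero locus of a set of homogeneous
polynomials, and its homogeneous vanishing ideal is prime (irreducibility). -/
def IsProjectiveVariety (X : Set (Pn n)) : Prop :=
  (∃ S : Set (MvPolynomial (Fin (n + 1)) ℂ),
    (∀ p ∈ S, ∃ d, p.IsHomogeneous d) ∧
    X = {x | ∀ p ∈ S, eval x.rep p = 0}) ∧
  Ideal.IsPrime
    { carrier := {p : MvPolynomial (Fin (n + 1)) ℂ | ∀ v ∈ cone n X, eval v p = 0}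
      add_mem' := fun hp hq v hv => by simp [hp v hv, hq v hv]
      zero_mem' := fun v _ => by simp
      smul_mem' := fun c p hp v hv => by simp [hp v hv] }

/-- The degree of a projective variety `X ⊆ ℙⁿ`, characterized as the greatest
cardinality of a finite intersection of `X` with (the projectivization of) a linear
subspace; the maximum is attained by generic linear subspaces of complementary
dimension. -/
def IsDegree (X : Set (Pn n)) (d : ℕ) : Prop :=
  IsGreatest {m | ∃ W : Submodule ℂ (Fin (n + 1) → ℂ),
    (X ∩ {x | x.rep ∈ W}).Finite ∧ (X ∩ {x | x.rep ∈ W}).ncard = m} d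

theorem bk_group_part (p : ℕ) [hp : Fact p.Prime] : ∀ (k : ℕ) (E : Type) [Group E] (Z : Subgroup E),
    Z ≤ Subgroup.center E → (∀ z ∈ Z, ∃ w ∈ Z, w ^ p = z) →
    ({z : E | z ∈ Z ∧ z ^ p = 1}.Finite ∧ {z : E | z ∈ Z ∧ z ^ p = 1}.ncard ≤ p) →
    Z.index = p ^ k →
    ∃ H : Subgroup E, H ⊓ Z = ⊥ ∧ Finite H ∧ p ^ k ≤ (Nat.card H) ^ 2 := by
  intro k
  induction k using Nat.strong_induction_on with
  | _ k ih =>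
  classical
  intro E _ Z hZc hdiv htor hidx
  have hcomm : ∀ z ∈ Z, ∀ g : E, g * z = z * g := fun z hz g =>
    (Subgroup.mem_center_iff.1 (hZc hz) g)
  rcases Nat.eq_zero_or_pos k with rfl | hk
  · exact ⟨⊥, by simp, inferInstance, by simp⟩
  have hZn : Z.Normal := ⟨fun z hz g => by
    rw [hcomm z hz g, mul_assoc, mul_inv_cancel, mul_one]; exact hz⟩
  have hp1 := hp.out.one_lt
  have hcardQ : Nat.card (E ⧸ Z) = p ^ k := hidx
  have hQfin : Finite (E ⧸ Z) := Nat.finite_of_card_ne_zero (by rw [hcardQ]; positivity)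
  have hQp : IsPGroup p (E ⧸ Z) := IsPGroup.of_card hcardQ
  have hQnt : Nontrivial (E ⧸ Z) := by
    rw [← Finite.one_lt_card_iff_nontrivial, hcardQ]
    exact Nat.one_lt_pow hk.ne' hp1
  have hcn := hQp.center_nontrivial
  have hdvd : p ∣ Nat.card (Subgroup.center (E ⧸ Z)) := by
    obtain ⟨j, hj, hj'⟩ := (hQp.to_subgroup (Subgroup.center (E ⧸ Z))).nontrivial_iff_card.1 hcn
    rw [hj']; exact dvd_pow_self p hj.ne'
  obtain ⟨c, hc⟩ := exists_prime_orderOf_dvd_card' p hdvd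
  obtain ⟨z0, hz0⟩ := QuotientGroup.mk_surjective (c : E ⧸ Z)
  have hz0Z : z0 ∉ Z := by
    intro h
    have : (c : E ⧸ Z) = 1 := by rw [← hz0]; exact (QuotientGroup.eq_one_iff _).2 h
    have : c = 1 := Subtype.ext this
    rw [this, orderOf_one] at hc
    omega
  have hz0p : z0 ^ p ∈ Z := by
    rw [← QuotientGroup.eq_one_iff, QuotientGroup.mk_pow, hz0]
    have := pow_orderOf_eq_one c
    rw [hc] at this
    exact_mod_cast congrArg Subtype.val this
  have hz0c : ∀ g : E, g * z0 * g⁻¹ * z0⁻¹ ∈ Z := by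
    intro g
    rw [← QuotientGroup.eq_one_iff]
    simp only [QuotientGroup.mk_mul, QuotientGroup.mk_inv, hz0]
    rw [Subgroup.mem_center_iff.1 c.2 (g : E ⧸ Z)]
    group
  obtain ⟨w, hwZ, hw⟩ := hdiv _ hz0p
  obtain ⟨z, hz⟩ : ∃ z, z = z0 * w⁻¹ := ⟨_, rfl⟩
  have hzp : z ^ p = 1 := by
    have hcm : Commute z0 w⁻¹ := (hcomm _ (Z.inv_mem hwZ) z0)
    rw [hz, hcm.mul_pow, inv_pow, hw, mul_inv_cancel]
  have hzZ : z ∉ Z := by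
    intro h; apply hz0Z
    have : z0 = z * w := by rw [hz]; group
    rw [this]; exact Z.mul_mem h hwZ
  have hzc : ∀ g : E, g * z * g⁻¹ * z⁻¹ ∈ Z := by
    intro g
    have : g * z * g⁻¹ * z⁻¹ = g * z0 * g⁻¹ * z0⁻¹ := by
      have h2 := hcomm _ (Z.inv_mem hwZ) g⁻¹
      rw [hz, mul_inv_rev, inv_inv]
      calc g * (z0 * w⁻¹) * g⁻¹ * (w * z0⁻¹) = g * z0 * (w⁻¹ * g⁻¹) * w * z0⁻¹ := by group
        _ = _ := by rw [← h2]; group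
    rw [this]; exact hz0c g
  have hzord : orderOf z = p := orderOf_eq_prime hzp (fun h => hzZ (h ▸ Z.one_mem))

  obtain ⟨K, hK⟩ : ∃ K : Subgroup E, K = Subgroup.centralizer {z} := ⟨_, rfl⟩
  have hmemK : ∀ g, g ∈ K ↔ g * z = z * g := by
    intro g; rw [hK, Subgroup.mem_centralizer_singleton_iff]
  have hKidx : K.index ≤ p := by
    have hfin := htor.1.to_subtype
    let F : E ⧸ K → {z : E | z ∈ Z ∧ z ^ p = 1} := fun q => 
      ⟨q.out * z * q.out⁻¹ * z⁻¹, hzc _, by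
        have hζ := hzc q.out
        have hcm : Commute (q.out * z * q.out⁻¹ * z⁻¹) z := (hcomm _ hζ z).symm
        have h1 := hcm.mul_pow p
        rw [hzp, mul_one, inv_mul_cancel_right, conj_pow, hzp] at h1
        rw [← h1]; group⟩
    have hF : Function.Injective F := by
      intro a b hab
      have h1 : a.out * z * a.out⁻¹ * z⁻¹ = b.out * z * b.out⁻¹ * z⁻¹ := congrArg Subtype.val hab
      have h2 : a.out * z * a.out⁻¹ = b.out * z * b.out⁻¹ := mul_right_cancel h1
      rw [← a.out_eq, ← b.out_eq]
      apply QuotientGroup.eq.2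
      rw [hmemK]
      have h3 : z = a.out⁻¹ * (b.out * z * b.out⁻¹) * a.out := by rw [← h2]; group
      calc a.out⁻¹ * b.out * z = (a.out⁻¹ * (b.out * z * b.out⁻¹) * a.out) * (a.out⁻¹ * b.out) := by group
        _ = _ := by rw [← h3]
    calc K.index = Nat.card (E ⧸ K) := rfl
      _ ≤ Nat.card {z : E | z ∈ Z ∧ z ^ p = 1} := Nat.card_le_card_of_injective F hF
      _ ≤ p := by rw [Nat.card_coe_set_eq]; exact htor.2
  have hZK : Z ≤ K := fun x hx => (hmemK x).2 (hcomm x hx z).symm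
  have hzK : z ∈ K := (hmemK z).2 rfl
  let zK : K := ⟨z, hzK⟩
  let N : Subgroup K := Subgroup.zpowers zK
  have hNc : ∀ x ∈ N, ∀ g : K, g * x = x * g := by
    rintro x hx g
    obtain ⟨i, rfl⟩ := Subgroup.mem_zpowers_iff.1 hx
    have : Commute g zK := Subtype.ext ((hmemK g).1 g.2)
    exact this.zpow_right i
  have hNn : N.Normal := ⟨fun x hx g => by
    rw [hNc x hx g, mul_assoc, mul_inv_cancel, mul_one]; exact hx⟩
  have hNcard : Nat.card N = p := by
    rw [Nat.card_zpowers, ← hzord]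
    exact (Subgroup.orderOf_mk z hzK)
  let ZK : Subgroup K := Z.subgroupOf K
  have hZKn : ZK.Normal := inferInstance
  have hdisj : ∀ x : K, x ∈ ZK → x ∈ N → x = 1 := by
    have h1 : ZK ⊓ N = ⊥ := by
      have hdv : Nat.card (ZK ⊓ N : Subgroup K) ∣ p := by
        rw [← hNcard]; exact Subgroup.card_dvd_of_le inf_le_right
      rcases (Nat.dvd_prime hp.out).1 hdv with h | h
      · exact Subgroup.card_eq_one.1 h
      · exfalso
        have : Finite N := Nat.finite_of_card_ne_zero (by rw [hNcard]; omega)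
        have h2 : ZK ⊓ N = N := Subgroup.eq_of_le_of_card_ge inf_le_right (by rw [h, hNcard])
        have h3 : zK ∈ ZK ⊓ N := by rw [h2]; exact Subgroup.mem_zpowers zK
        exact hzZ (Subgroup.mem_subgroupOf.1 h3.1)
    intro x h2 h3
    have : x ∈ ZK ⊓ N := ⟨h2, h3⟩
    rw [h1] at this; exact Subgroup.mem_bot.1 this
  let f := QuotientGroup.mk' N
  have hfs : Function.Surjective f := QuotientGroup.mk'_surjective N
  have hker : f.ker = N := QuotientGroup.ker_mk' N
  have hinj : ∀ x ∈ ZK, f x = 1 → x = 1 := fun x hx h => hdisj x hx (by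
    rw [← hker]; exact h)
  let Z' := ZK.map f
  have hidx' : Z'.index * p * K.index = p ^ k := by
    have h1 : Z'.index = (ZK ⊔ N).index := by
      rw [Subgroup.index_map, hker, MonoidHom.range_eq_top.2 hfs, Subgroup.index_top, mul_one]
    have h2 : ZK.relIndex (ZK ⊔ N) = p := by
      rw [Subgroup.relIndex_sup_left, ← Subgroup.inf_relIndex_right]
      have : ZK ⊓ N = ⊥ := by
        rw [eq_bot_iff]; intro x hx; exact Subgroup.mem_bot.2 (hdisj x hx.1 hx.2)
      rw [this, Subgroup.relIndex_bot_left, hNcard]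
    have h3 := Subgroup.relIndex_mul_index (H := ZK) (K := ZK ⊔ N) le_sup_left
    have h4 := Subgroup.relIndex_mul_index hZK
    have h5 : Z.relIndex K = ZK.index := rfl
    rw [h2] at h3
    rw [h5, ← h3, hidx] at h4
    rw [h1, ← h4]; ring
  obtain ⟨j, hjk, hj⟩ : ∃ j ≤ k, Z'.index = p ^ j := 
    (Nat.dvd_prime_pow hp.out).1 ⟨p * K.index, by rw [← hidx']; ring⟩
  have hjlt : j < k := by
    rw [hj] at hidx'
    have hKpos : 0 < K.index := by
      rcases Nat.eq_zero_or_pos K.index with h | h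
      · rw [h] at hidx'; have : 0 < p ^ k := by positivity
        omega
      · exact h
    rw [← Nat.pow_lt_pow_iff_right hp1, ← hidx', mul_assoc]
    have : 0 < p ^ j := by positivity
    have h2 : 1 < p * K.index := lt_of_lt_of_le hp1 (Nat.le_mul_of_pos_right _ hKpos)
    nlinarith
  obtain ⟨H', hH'1, hH'2, hH'3⟩ := ih j hjlt (K ⧸ N) Z' (by
      rintro _ ⟨x, hx, rfl⟩
      rw [Subgroup.mem_center_iff]
      intro g
      obtain ⟨g, rfl⟩ := hfs g
      rw [← map_mul, ← map_mul]
      congr 1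
      exact Subtype.ext (hcomm _ (Subgroup.mem_subgroupOf.1 hx) g)) (by
      rintro _ ⟨x, hx, rfl⟩
      obtain ⟨w, hw, hw'⟩ := hdiv _ (Subgroup.mem_subgroupOf.1 hx)
      refine ⟨f ⟨w, hZK hw⟩, ⟨⟨w, hZK hw⟩, Subgroup.mem_subgroupOf.2 hw, rfl⟩, ?_⟩
      rw [← map_pow]; congr 1; exact Subtype.ext hw') (by
      have hsub : {y : K ⧸ N | y ∈ Z' ∧ y ^ p = 1} ⊆ 
          (fun x : E => if h : x ∈ K then f ⟨x, h⟩ else 1) '' {z : E | z ∈ Z ∧ z ^ p = 1} := by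
        rintro _ ⟨⟨x, hx, rfl⟩, hxp⟩
        refine ⟨x, ⟨Subgroup.mem_subgroupOf.1 hx, ?_⟩, ?_⟩
        · rw [← map_pow] at hxp
          exact congrArg Subtype.val (hinj _ (ZK.pow_mem hx p) hxp)
        · simp
      refine ⟨(htor.1.image _).subset hsub, ?_⟩
      exact ((Set.ncard_le_ncard hsub (htor.1.image _)).trans (Set.ncard_image_le htor.1)).trans htor.2)
    hj
  have hcardH : Nat.card (H'.comap f) = p * Nat.card H' := by
    have h1 : f.ker ≤ H'.comap f := by
      intro x hx; rw [Subgroup.mem_comap, MonoidHom.mem_ker.1 hx]; exact H'.one_mem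
    have h2 := Subgroup.relIndex_mul_relIndex (⊥ : Subgroup K) f.ker (H'.comap f) bot_le h1
    have h3 : f.ker.relIndex (H'.comap f) = Nat.card H' := by
      rw [← MonoidHom.comap_bot, Subgroup.relIndex_comap, Subgroup.map_comap_eq_self_of_surjective hfs,
        Subgroup.relIndex_bot_left]
    rw [Subgroup.relIndex_bot_left, Subgroup.relIndex_bot_left, h3, hker, hNcard] at h2
    exact h2.symm
  have hcardH2 : Nat.card ((H'.comap f).map K.subtype) = p * Nat.card H' := by
    rw [← hcardH]
    exact (Nat.card_congr ((H'.comap f).equivMapOfInjective K.subtype K.subtype_injective).toEquiv).symm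
  refine ⟨(H'.comap f).map K.subtype, ?_, ?_, ?_⟩
  · rw [eq_bot_iff]
    rintro _ ⟨⟨x, hx, rfl⟩, hxZ⟩
    have h1 : x ∈ ZK := Subgroup.mem_subgroupOf.2 hxZ
    have h2 : f x ∈ H' ⊓ Z' := ⟨hx, ⟨x, h1, rfl⟩⟩
    rw [hH'1] at h2
    have := hinj x h1 (Subgroup.mem_bot.1 h2)
    rw [this]; simp
  · apply Nat.finite_of_card_ne_zero
    rw [hcardH2]
    have := Nat.card_pos (α := H')
    positivity
  · rw [hcardH2]
    rw [hj] at hidx'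
    calc p ^ k = p ^ j * p * K.index := hidx'.symm
      _ ≤ p ^ j * p * p := Nat.mul_le_mul_left _ hKidx
      _ ≤ (Nat.card H')^2 * p * p := by gcongr
      _ = _ := by ring

open Polynomial in
theorem bk_ext_hom {R S : Type*} [CommRing R] [CommRing S] [IsDomain S] [Algebra R S]
    [Algebra.IsIntegral R S] (φ : R →+* ℂ) (h : RingHom.ker (algebraMap R S) ≤ RingHom.ker φ) :
    ∃ ψ : S →+* ℂ, ψ.comp (algebraMap R S) = φ := by
  have hP : (RingHom.ker φ).IsPrime := RingHom.ker_isPrime φ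
  obtain ⟨Q, hQ, hQP⟩ := Ideal.exists_ideal_over_prime_of_isIntegral_of_isDomain (S := S)
    (RingHom.ker φ) h
  let R' := R ⧸ (RingHom.ker φ)
  have : IsDomain R' := Ideal.Quotient.isDomain _
  have : IsDomain (S ⧸ Q) := Ideal.Quotient.isDomain _
  let i : R' →+* S ⧸ Q := Ideal.quotientMap Q (algebraMap R S) hQP.ge
  have hi : Function.Injective i := Ideal.quotientMap_injective' hQP.le
  let j : R' →+* ℂ := RingHom.kerLift φ
  have hj : Function.Injective j := RingHom.kerLift_injective φ
  let _ : Algebra R' (S ⧸ Q) := i.toAlgebra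
  let _ : Algebra R' ℂ := j.toAlgebra
  have : Module.IsTorsionFree R' (S ⧸ Q) := Module.isTorsionFree_iff_algebraMap_injective.2 hi
  have : Module.IsTorsionFree R' ℂ := Module.isTorsionFree_iff_algebraMap_injective.2 hj
  have : Algebra.IsIntegral R' (S ⧸ Q) := by
    constructor
    intro x
    obtain ⟨s, rfl⟩ := Ideal.Quotient.mk_surjective x
    obtain ⟨p, hp, hp0⟩ := Algebra.IsIntegral.isIntegral (R := R) s
    refine ⟨p.map (Ideal.Quotient.mk _), hp.map _, ?_⟩
    rw [Polynomial.eval₂_map]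
    have : (algebraMap R' (S ⧸ Q)).comp (Ideal.Quotient.mk (RingHom.ker φ)) =
      (Ideal.Quotient.mk Q).comp (algebraMap R S) := by
      ext r; rfl
    rw [this, ← Polynomial.hom_eval₂, hp0, map_zero]
  let l : S ⧸ Q →ₐ[R'] ℂ := IsAlgClosed.lift
  refine ⟨(l : S ⧸ Q →+* ℂ).comp (Ideal.Quotient.mk Q), ?_⟩
  ext r
  have := l.commutes (Ideal.Quotient.mk _ r)
  exact this

theorem bk_card_dvd_field {K L H : Type*} [Field K] [Field L] [Algebra K L] [FiniteDimensional K L]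
    [Group H] [Finite H] (τ : H →* Gal(L/K)) (hτ : Function.Injective τ) :
    Nat.card H ∣ Module.finrank K L := by
  have h1 := IntermediateField.finrank_fixedField_eq_card (F := K) (E := L) τ.range
  have h2 : Nat.card τ.range = Nat.card H := 
    (Nat.card_congr (MonoidHom.ofInjective hτ).toEquiv).symm
  rw [← h2, ← h1, ← Module.finrank_mul_finrank K (IntermediateField.fixedField τ.range) L]
  exact Dvd.intro_left _ rfl

section
variable (B S : Type*) [CommRing B] [IsDomain B] [CommRing S] [IsDomain S] [Algebra B S]
  [Module.Finite B S] [FaithfulSMul B S]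

attribute [local instance] FractionRing.liftAlgebra

theorem bk_finrank_frac : Module.finrank (FractionRing B) (FractionRing S) = Module.finrank B S :=
  IsFractionRing.finrank_eq B (FractionRing B) S (FractionRing S)

theorem bk_findim_frac : FiniteDimensional (FractionRing B) (FractionRing S) := 
  Module.Finite.of_isLocalization B S (nonZeroDivisors B)

open Polynomial in
theorem bk_minpoly_bound [IsIntegrallyClosed B] (θ : S) :
    ∃ f : B[X], f.Monic ∧ f.natDegree ≤ Module.finrank B S ∧ aeval θ f = 0 := by
  have hintg : IsIntegral B θ := Algebra.IsIntegral.isIntegral θ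
  have := bk_findim_frac B S
  refine ⟨minpoly B θ, minpoly.monic hintg, ?_, minpoly.aeval _ _⟩
  rw [← bk_finrank_frac, ← (minpoly.monic hintg).natDegree_map (algebraMap B (FractionRing B)),
    ← minpoly.isIntegrallyClosed_eq_field_fractions (FractionRing B) (FractionRing S) hintg]
  exact minpoly.natDegree_le _

theorem bk_card_dvd (H : Type*) [Group H] [Finite H] (ρ : H →* (S ≃ₐ[B] S))
    (hρ : Function.Injective ρ) : Nat.card H ∣ Module.finrank B S := by
  have := bk_findim_frac B S
  let τ := (IsFractionRing.fieldEquivOfAlgEquivHom (A := B) (B := S) (FractionRing B)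
    (FractionRing S)).comp ρ
  have hτ : Function.Injective τ := 
    (IsFractionRing.fieldEquivOfAlgEquivHom_injective B S (FractionRing B) (FractionRing S)).comp hρ
  rw [← bk_finrank_frac]
  exact bk_card_dvd_field τ hτ

open Polynomial in
theorem bk_fibre [IsIntegrallyClosed B] [CharZero B] :
    ∃ θ : S, ∃ b : B, b ≠ 0 ∧ ∀ φ : B →+* ℂ, φ b ≠ 0 → ∃ R : Finset ℂ,
      R.card = Module.finrank B S ∧ ∀ r ∈ R, ∃ ψ : S →+* ℂ, ψ.comp (algebraMap B S) = φ ∧ ψ θ = r := by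
  have := bk_findim_frac B S
  have hK0 : CharZero (FractionRing B) := 
    charZero_of_injective_algebraMap (IsFractionRing.injective B (FractionRing B))
  obtain ⟨α, hα⟩ := Field.exists_primitive_element (FractionRing B) (FractionRing S)
  obtain ⟨s, ⟨_, c, hc, rfl⟩, hsc⟩ := IsLocalization.exists_mk'_eq
    (Algebra.algebraMapSubmonoid S (nonZeroDivisors B)) α
  have hc0 : c ≠ 0 := nonZeroDivisors.ne_zero hc
  have hcK : algebraMap B (FractionRing B) c ≠ 0 := by
    rwa [Ne, FaithfulSMul.algebraMap_eq_zero_iff]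
  have hsα : algebraMap S (FractionRing S) s = algebraMap B (FractionRing B) c • α := by
    have := (IsLocalization.eq_mk'_iff_mul_eq.1 hsc.symm)
    rw [← this, Algebra.smul_def, mul_comm, ← IsScalarTower.algebraMap_apply,
      ← IsScalarTower.algebraMap_apply]
  have htop : IntermediateField.adjoin (FractionRing B) {algebraMap S (FractionRing S) s} = ⊤ := by
    rw [eq_top_iff, ← hα, IntermediateField.adjoin_simple_le_iff]
    have h1 := IntermediateField.mem_adjoin_simple_self (FractionRing B) (algebraMap S (FractionRing S) s)
    have h2 : α = (algebraMap B (FractionRing B) c)⁻¹ • algebraMap S (FractionRing S) s := by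
      rw [hsα, smul_smul, inv_mul_cancel₀ hcK, one_smul]
    rw [h2]
    exact IntermediateField.smul_mem _ h1
  have hintg : IsIntegral B s := Algebra.IsIntegral.isIntegral s
  have hmap := minpoly.isIntegrallyClosed_eq_field_fractions (FractionRing B) (FractionRing S) hintg
  set f := minpoly B s with hf
  have hfm : f.Monic := minpoly.monic hintg
  have hintL : IsIntegral (FractionRing B) (algebraMap S (FractionRing S) s) := 
    Algebra.IsIntegral.isIntegral _
  have hdeg : f.natDegree = Module.finrank B S := by
    rw [← bk_finrank_frac, ← hfm.natDegree_map (algebraMap B (FractionRing B)), ← hmap,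
      ← IntermediateField.adjoin.finrank hintL, htop, IntermediateField.finrank_top']
  have hsep : (f.map (algebraMap B (FractionRing B))).Separable := by
    rw [← hmap]; exact (minpoly.irreducible hintL).separable
  obtain ⟨u, v, huv⟩ := hsep
  obtain ⟨b1, hbm1, hb1⟩ := IsLocalization.integerNormalization_spec (nonZeroDivisors B) u
  obtain ⟨b2, hbm2, hb2⟩ := IsLocalization.integerNormalization_spec (nonZeroDivisors B) v
  set u0 := IsLocalization.integerNormalization (nonZeroDivisors B) u
  set v0 := IsLocalization.integerNormalization (nonZeroDivisors B) v
  rw [algebra_compatible_smul (FractionRing B), Polynomial.smul_eq_C_mul] at hb1 hb2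
  have hkey : Polynomial.C (b2 : B) * u0 * f + Polynomial.C (b1 : B) * v0 * derivative f = Polynomial.C ((b1 : B) * b2) := by
    apply Polynomial.map_injective (algebraMap B (FractionRing B)) (IsFractionRing.injective _ _)
    simp only [Polynomial.map_add, Polynomial.map_mul, Polynomial.map_C, hb1, hb2, map_mul]
    rw [derivative_map] at huv
    linear_combination (Polynomial.C ((algebraMap B (FractionRing B)) b1) * Polynomial.C ((algebraMap B (FractionRing B)) b2)) * huv
  refine ⟨s, b1 * b2, mul_ne_zero (nonZeroDivisors.ne_zero hbm1) (nonZeroDivisors.ne_zero hbm2), ?_⟩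
  intro φ hφ
  have hsepφ : (f.map φ).Separable := by
    have h1 := congrArg (Polynomial.map φ) hkey
    simp only [Polynomial.map_add, Polynomial.map_mul, Polynomial.map_C] at h1
    refine ⟨Polynomial.C (φ (b1 * b2))⁻¹ * ((Polynomial.C (φ b2)) * u0.map φ), Polynomial.C (φ (b1 * b2))⁻¹ * ((Polynomial.C (φ b1)) * v0.map φ), ?_⟩
    have h2 : Polynomial.C (φ (b1 * b2))⁻¹ * Polynomial.C (φ (b1 * b2)) = 1 := by
      rw [← Polynomial.C_mul, inv_mul_cancel₀ hφ, Polynomial.C_1]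
    rw [derivative_map, ← h2, ← h1]
    ring
  refine ⟨(f.map φ).roots.toFinset, ?_, ?_⟩
  · rw [Multiset.toFinset_card_of_nodup (nodup_roots hsepφ), 
      ← (IsAlgClosed.splits (f.map φ)).natDegree_eq_card_roots, hfm.natDegree_map, hdeg]
  · intro r hr
    have hr' : (f.map φ).eval r = 0 := by
      have := (Multiset.mem_toFinset.1 hr)
      exact (mem_roots'.1 this).2
    let _ : Algebra B[X] S := (aeval (R := B) s).toRingHom.toAlgebra
    have hval : ∀ q : B[X], algebraMap B[X] S q = aeval s q := fun q => rfl
    have : IsScalarTower B B[X] S := IsScalarTower.of_algebraMap_eq (fun x => by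
      rw [hval, Polynomial.algebraMap_eq, Polynomial.aeval_C])
    have : Algebra.IsIntegral B[X] S := Algebra.IsIntegral.tower_top B
    obtain ⟨ψ, hψ⟩ := bk_ext_hom (S := S) (eval₂RingHom φ r) (by
      intro q hq
      rw [RingHom.mem_ker, hval] at hq
      obtain ⟨q', rfl⟩ := minpoly.isIntegrallyClosed_dvd hintg hq
      rw [RingHom.mem_ker, coe_eval₂RingHom, Polynomial.eval₂_mul, ← hf, ← Polynomial.eval_map, hr', zero_mul])
    refine ⟨ψ, ?_, ?_⟩
    · ext x
      have := RingHom.congr_fun hψ (Polynomial.C x)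
      simpa [hval] using this
    · have := RingHom.congr_fun hψ X
      simpa [hval] using this
end

theorem bk_eval_smul {σ : Type*} {p : MvPolynomial σ ℂ} {k : ℕ} (hp : p.IsHomogeneous k) (c : ℂ)
    (v : σ → ℂ) : eval (c • v) p = c ^ k * eval v p := by
  rw [eval_eq, eval_eq, Finset.mul_sum]
  refine Finset.sum_congr rfl fun d hd => ?_
  have h := hp (mem_support_iff.1 hd)
  have h2 : ∏ i ∈ d.support, (c • v) i ^ d i = c ^ k * ∏ i ∈ d.support, v i ^ d i := by
    simp only [Pi.smul_apply, smul_eq_mul, mul_pow, Finset.prod_mul_distrib]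
    rw [Finset.prod_pow_eq_pow_sum]
    congr 2
    rw [← h, Finsupp.weight_apply]
    simp [Finsupp.sum]
  rw [h2]; ring

theorem bk_hom_vanish {σ : Type*} (A : Set (σ → ℂ)) (hA : ∀ v ∈ A, ∀ c : ℂ, c ≠ 0 → c • v ∈ A)
    (p : MvPolynomial σ ℂ) (hp : ∀ v ∈ A, eval v p = 0) (j : ℕ) :
    ∀ v ∈ A, eval v (homogeneousComponent j p) = 0 := by
  intro v hv
  by_cases hj : p.totalDegree < j
  · rw [homogeneousComponent_eq_zero _ _ hj]; simp
  push Not at hj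
  let q : Polynomial ℂ := ∑ i ∈ Finset.range (p.totalDegree + 1),
    Polynomial.monomial i (eval v (homogeneousComponent i p))
  have hq : ∀ c : ℂ, c ≠ 0 → q.eval c = 0 := by
    intro c hc
    have h1 := hp _ (hA v hv c hc)
    rw [← sum_homogeneousComponent p, map_sum] at h1
    rw [← h1, Polynomial.eval_finsetSum]
    refine Finset.sum_congr rfl fun i _ => ?_
    rw [bk_eval_smul (homogeneousComponent_isHomogeneous i p), Polynomial.eval_monomial, mul_comm]
  have hq0 : q = 0 := by
    refine Polynomial.eq_zero_of_infinite_isRoot q ?_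
    refine Set.Infinite.mono (s := {0}ᶜ) (fun c hc => hq c hc) ?_
    exact (Set.finite_singleton (0:ℂ)).infinite_compl
  have := congrArg (fun r => Polynomial.coeff r j) hq0
  simpa [q, Polynomial.finsetSum_coeff, Polynomial.coeff_monomial, Nat.lt_succ_iff, hj] using this

theorem bk_comp_mul {σ : Type*} {f : MvPolynomial σ ℂ} {m N : ℕ} (hf : f.IsHomogeneous m) (hN : m ≤ N)
    (q : MvPolynomial σ ℂ) : homogeneousComponent N (q * f) = homogeneousComponent (N - m) q * f := by
  conv_lhs => rw [← sum_homogeneousComponent q]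
  rw [Finset.sum_mul, map_sum]
  have h : ∀ i ∈ Finset.range (q.totalDegree + 1),
      homogeneousComponent N (homogeneousComponent i q * f) =
        if i = N - m then homogeneousComponent i q * f else 0 := by
    intro i _
    have h1 : homogeneousComponent i q * f ∈ homogeneousSubmodule σ ℂ (i + m) :=
      (homogeneousComponent_isHomogeneous i q).mul hf
    rw [homogeneousComponent_of_mem h1]
    have : N = i + m ↔ i = N - m := by omega
    simp only [this]
  rw [Finset.sum_congr rfl h, Finset.sum_ite_eq']
  split_ifs with h2
  · rfl
  · rw [homogeneousComponent_eq_zero, zero_mul]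
    simp at h2; omega

structure BkCone {σ : Type} (A : Set (σ → ℂ)) : Prop where
  ne_zero : ∀ v ∈ A, v ≠ 0
  smul : ∀ v ∈ A, ∀ c : ℂ, c ≠ 0 → c • v ∈ A
  closed : ∀ v, v ≠ 0 → (∀ p : MvPolynomial σ ℂ, (∀ w ∈ A, eval w p = 0) → eval v p = 0) → v ∈ A
  nonempty : A.Nonempty

theorem bk_null {σ ι : Type} [Fintype σ] [Fintype ι] {A : Set (σ → ℂ)} (hA : BkCone A) {m : ℕ}
    (f : ι → MvPolynomial σ ℂ) (hf : ∀ i, (f i).IsHomogeneous m)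
    (nz : ∀ v ∈ A, ∃ i, eval v (f i) ≠ 0) :
    ∃ N, m ≤ N ∧ ∀ i : σ, ∃ q : ι → MvPolynomial σ ℂ, (∀ l, (q l).IsHomogeneous (N - m)) ∧
      ∀ v ∈ A, eval v (X i ^ N) = eval v (∑ l, q l * f l) := by
  classical
  let J : Ideal (MvPolynomial σ ℂ) := vanishingIdeal ℂ A ⊔ Ideal.span (Set.range f)
  have hX : ∀ i : σ, ∃ N, X i ^ N ∈ J := by
    intro i
    have : (X i : MvPolynomial σ ℂ) ∈ J.radical := by
      rw [← vanishingIdeal_zeroLocus_eq_radical (K := ℂ)]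
      intro v hv
      by_cases h0 : v = 0
      · simp [h0]
      exfalso
      have hvA : v ∈ A := hA.closed v h0 fun p hp => by
        have : p ∈ J := Ideal.mem_sup_left (fun x hx => by simpa using hp x hx)
        simpa using hv p this
      obtain ⟨l, hl⟩ := nz v hvA
      apply hl
      have : f l ∈ J := Ideal.mem_sup_right (Ideal.subset_span ⟨l, rfl⟩)
      simpa using hv _ this
    exact this
  choose Ni hNi using hX
  refine ⟨m + ∑ i, Ni i, by omega, fun i => ?_⟩
  set N := m + ∑ i, Ni i with hN
  have hle : Ni i ≤ N := (Finset.single_le_sum (f := Ni) (fun _ _ => Nat.zero_le _) (Finset.mem_univ i)).trans (by omega)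
  have hmem : (X i ^ N : MvPolynomial σ ℂ) ∈ J := J.pow_mem_of_pow_mem (hNi i) hle
  obtain ⟨g, hg, h, hh, hgh⟩ := Submodule.mem_sup.1 hmem
  obtain ⟨q, hq⟩ := (Ideal.mem_span_range_iff_exists_fun).1 hh
  refine ⟨fun l => homogeneousComponent (N - m) (q l), fun l => homogeneousComponent_isHomogeneous _ _, fun v hv => ?_⟩
  have h1 : (X i ^ N : MvPolynomial σ ℂ) = homogeneousComponent N g +
      ∑ l, homogeneousComponent (N - m) (q l) * f l := by
    have h2 : homogeneousComponent N (X i ^ N : MvPolynomial σ ℂ) = X i ^ N :=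
      homogeneousComponent_eq_self (isHomogeneous_X_pow i N)
    rw [← h2, ← hgh, map_add, ← hq, map_sum]
    congr 1
    exact Finset.sum_congr rfl fun l _ => bk_comp_mul (hf l) (by omega) _
  rw [h1, map_add, bk_hom_vanish A hA.smul g (fun w hw => by simpa using hg w hw) N v hv, zero_add]

def bkW {S τ : Type} [CommRing S] [Algebra ℂ S] (f : τ → S) (Γ : Set S) (k : ℕ) : Submodule ℂ S :=
  Submodule.span ℂ {x | ∃ b : MvPolynomial τ ℂ, b.totalDegree ≤ k ∧ ∃ s ∈ Γ, x = aeval f b * s}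

theorem bkW_mul {S τ : Type} [CommRing S] [Algebra ℂ S] (f : τ → S) (Γ : Set S) (k : ℕ) (l : τ)
    (x : S) (hx : x ∈ bkW f Γ k) : f l * x ∈ bkW f Γ (k + 1) := by
  induction hx using Submodule.span_induction with
  | mem x h =>
    obtain ⟨b, hb, s, hs, rfl⟩ := h
    refine Submodule.subset_span ⟨X l * b, ?_, s, hs, by simp [mul_assoc]⟩
    refine (totalDegree_mul _ _).trans ?_
    have : (X l : MvPolynomial τ ℂ).totalDegree = 1 := totalDegree_X l
    omega
  | zero => simp
  | add x y _ _ h1 h2 => rw [mul_add]; exact add_mem h1 h2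
  | smul c x _ h => rw [mul_smul_comm]; exact Submodule.smul_mem _ _ h

theorem bk_lemmaA {σ ι S : Type} [Fintype σ] [Fintype ι] [CommRing S] [Algebra ℂ S]
    {A : Set (σ → ℂ)} (hA : BkCone A) (π : MvPolynomial σ ℂ →ₐ[ℂ] S)
    (hπ : ∀ p, π p = 0 ↔ ∀ v ∈ A, eval v p = 0) {m : ℕ} (hm : 1 ≤ m)
    (f : ι → MvPolynomial σ ℂ) (hf : ∀ i, (f i).IsHomogeneous m)
    (nz : ∀ v ∈ A, ∃ i, eval v (f i) ≠ 0) :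
    ∃ Γ : Set S, Γ.Finite ∧ ∀ k p, p.totalDegree ≤ m * k → π p ∈ bkW (fun i => π (f i)) Γ k := by
  classical
  obtain ⟨N, hmN, hN⟩ := bk_null hA f hf nz
  choose q hq hqv using hN
  let M := Fintype.card σ * N + 1
  let Γ : Set S := (fun d : σ →₀ ℕ => π (monomial d 1)) '' {d | d.degree ≤ M}
  have key : ∀ D : ℕ, ∀ d : σ →₀ ℕ, d.degree ≤ D → ∀ k, d.degree ≤ m * k →
      π (monomial d 1) ∈ bkW (fun i => π (f i)) Γ k := by
    intro D
    induction D with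
    | zero =>
      intro d hd k hk
      exact Submodule.subset_span ⟨1, by simp, _, ⟨d, by simp; omega, rfl⟩, by simp⟩
    | succ D ih =>
      intro d hd k hk
      by_cases hdM : d.degree ≤ M
      · exact Submodule.subset_span ⟨1, by simp, _, ⟨d, hdM, rfl⟩, by simp⟩
      have hex : ∃ i, N ≤ d i := by
        by_contra hcon
        push Not at hcon
        have : d.degree ≤ Fintype.card σ * N := by
          rw [Finsupp.degree_eq_sum]
          refine (Finset.sum_le_card_nsmul Finset.univ _ N fun i _ => (hcon i).le).trans ?_
          simp
        omega
      obtain ⟨i, hi⟩ := hex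
      obtain ⟨k, rfl⟩ : ∃ k', k = k' + 1 := by
        cases k with
        | zero => omega
        | succ k => exact ⟨k, rfl⟩
      let d' := d - Finsupp.single i N
      have hd' : d = Finsupp.single i N + d' := by
        rw [add_tsub_cancel_of_le]
        simpa using hi
      have hdeg : d.degree = N + d'.degree := by
        conv_lhs => rw [hd']
        simp
      have h1 : π (monomial d 1) = ∑ l, π (f l) * π (q i l * monomial d' 1) := by
        have h2 : (monomial d 1 : MvPolynomial σ ℂ) = X i ^ N * monomial d' 1 := by
          conv_lhs => rw [hd']
          rw [X_pow_eq_monomial, monomial_mul, mul_one]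
        have h3 : π (X i ^ N) = π (∑ l, q i l * f l) := by
          rw [← sub_eq_zero, ← map_sub, hπ]
          intro v hv
          rw [map_sub, hqv i v hv, sub_self]
        rw [h2, map_mul, h3, map_sum, Finset.sum_mul]
        refine Finset.sum_congr rfl fun l _ => ?_
        simp only [map_mul]; ring
      rw [h1]
      refine Submodule.sum_mem _ fun l _ => bkW_mul _ _ _ _ _ ?_
      have h4 : (q i l * monomial d' 1).IsHomogeneous (N - m + d'.degree) :=
        (hq i l).mul (isHomogeneous_monomial _ rfl)
      rw [MvPolynomial.as_sum (q i l * monomial d' 1), map_sum]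
      refine Submodule.sum_mem _ fun e he => ?_
      have h5 : e.degree = N - m + d'.degree := by
        have := h4 (mem_support_iff.1 he)
        rw [← this, Finsupp.degree_eq_weight_one]; rfl
      have h6 : monomial e (coeff e (q i l * monomial d' 1)) =
        (coeff e (q i l * monomial d' 1)) • monomial e (1:ℂ) := by simp [smul_monomial]
      rw [h6, map_smul]
      refine Submodule.smul_mem _ _ (ih e (by omega) k ?_)
      rw [mul_add] at hk; omega
  refine ⟨Γ, ?_, fun k p hp => ?_⟩
  · refine Set.Finite.image _ ?_
    exact Finsupp.finite_of_degree_le M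
  · rw [MvPolynomial.as_sum p, map_sum]
    refine Submodule.sum_mem _ fun e he => ?_
    have h6 : monomial e (coeff e p) = (coeff e p) • monomial e (1:ℂ) := by simp [smul_monomial]
    rw [h6, map_smul]
    refine Submodule.smul_mem _ _ (key _ e le_rfl k ?_)
    exact (le_totalDegree he).trans hp

theorem bk_torsion (B S : Type*) [CommRing B] [IsDomain B] [AddCommGroup S] [Module B S]
    [Module.Finite B S] (D : ℕ) (hD : Module.finrank B S = D) (e : Fin D → S) (he : LinearIndependent B e)
    (Γ : Set S) (hΓ : Γ.Finite) :
    ∃ a : B, a ≠ 0 ∧ ∀ s ∈ Γ, a • s ∈ Submodule.span B (Set.range e) := by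
  have h1 : ∀ s : S, ∃ a : B, a ≠ 0 ∧ a • s ∈ Submodule.span B (Set.range e) := by
    intro s
    by_contra hcon
    push Not at hcon
    have h2 : LinearIndependent B (Fin.cons s e : Fin (D + 1) → S) := by
      refine LinearIndependent.finCons' s e he fun c y hy hcy => ?_
      by_contra hc
      refine hcon c hc ?_
      have : c • s = - y := eq_neg_of_add_eq_zero_left hcy
      rw [this]
      exact neg_mem hy
    have := h2.fintype_card_le_finrank
    simp [hD] at this
  induction Γ, hΓ using Set.Finite.induction_on with
  | empty => exact ⟨1, one_ne_zero, by simp⟩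
  | @insert s Γ _ _ ih =>
    obtain ⟨a, ha, h⟩ := ih
    obtain ⟨b, hb, h'⟩ := h1 s
    refine ⟨a * b, mul_ne_zero ha hb, fun x hx => ?_⟩
    rcases hx with rfl | hx
    · rw [mul_smul]; exact Submodule.smul_mem _ _ h'
    · rw [mul_comm, mul_smul]; exact Submodule.smul_mem _ _ (h x hx)

theorem bk_totalDegree_aeval {σ τ : Type} {m : ℕ} (f : τ → MvPolynomial σ ℂ)
    (hf : ∀ i, (f i).IsHomogeneous m) (b : MvPolynomial τ ℂ) (k : ℕ) (hb : b.totalDegree ≤ k) :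
    (aeval f b).totalDegree ≤ m * k := by
  rw [← sum_homogeneousComponent b, map_sum]
  refine totalDegree_finsetSum_le fun i hi => ?_
  have := ((homogeneousComponent_isHomogeneous i b).aeval f hf).totalDegree_le
  refine this.trans (Nat.mul_le_mul_left _ ?_)
  simp at hi; omega

noncomputable def bkU {σ S : Type} [CommRing S] [Algebra ℂ S] (π : MvPolynomial σ ℂ →ₐ[ℂ] S) (j : ℕ) :
    Submodule ℂ S := (restrictTotalDegree σ ℂ j).map π.toLinearMap

noncomputable def bkΦ {τ S : Type} [CommRing S] [Algebra ℂ S] (D k : ℕ) (g : τ → S) (e : Fin D → S) :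
    (Fin D → restrictTotalDegree τ ℂ k) →ₗ[ℂ] S :=
  ∑ i, (LinearMap.mulRight ℂ (e i)).comp
    ((aeval g).toLinearMap.comp ((restrictTotalDegree τ ℂ k).subtype.comp (LinearMap.proj i)))

theorem bkΦ_apply {τ S : Type} [CommRing S] [Algebra ℂ S] (D k : ℕ) (g : τ → S) (e : Fin D → S) (b) :
    bkΦ D k g e b = ∑ i, aeval g (b i : MvPolynomial τ ℂ) * e i := by
  simp [bkΦ]

section
variable {σ τ S : Type} [Fintype σ] [Fintype τ] [CommRing S] [IsDomain S] [Algebra ℂ S]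
    {A : Set (σ → ℂ)} (hA : BkCone A) (π : MvPolynomial σ ℂ →ₐ[ℂ] S)
    (hs : Function.Surjective π)
    (hπ : ∀ p, π p = 0 ↔ ∀ v ∈ A, eval v p = 0) {m : ℕ} (hm : 1 ≤ m)
    (f : τ → MvPolynomial σ ℂ) (hf : ∀ i, (f i).IsHomogeneous m)
    (nz : ∀ v ∈ A, ∃ i, eval v (f i) ≠ 0)
    [Algebra (MvPolynomial τ ℂ) S] 
    (halg : ∀ b : MvPolynomial τ ℂ, algebraMap _ S b = aeval (fun i => π (f i)) b)

include hA hs hπ hm hf nz halg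
omit [IsDomain S] in
theorem bk_finite : Module.Finite (MvPolynomial τ ℂ) S := by
  obtain ⟨Γ, hΓ, h⟩ := bk_lemmaA hA π hπ hm f hf nz
  refine ⟨⟨hΓ.toFinset, ?_⟩⟩
  rw [eq_top_iff]
  intro x _
  obtain ⟨p, rfl⟩ := hs x
  have hx := h p.totalDegree p (Nat.le_mul_of_pos_left _ hm)
  generalize π p = x at hx
  induction hx using Submodule.span_induction with
  | mem x h =>
    obtain ⟨b, hb, s, hs, rfl⟩ := h
    rw [← halg, ← Algebra.smul_def]
    exact Submodule.smul_mem _ _ (Submodule.subset_span (by simpa using hs))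
  | zero => simp
  | add x y _ _ h1 h2 => exact add_mem h1 h2
  | smul c x _ h =>
    have : c • x = (C c : MvPolynomial τ ℂ) • x := by
      rw [Algebra.smul_def (C c : MvPolynomial τ ℂ), halg, Algebra.smul_def]; simp
    rw [this]; exact Submodule.smul_mem _ _ h

theorem bk_lemmaC [FaithfulSMul (MvPolynomial τ ℂ) S] :
    ∃ c, ∀ k, Module.finrank ℂ (bkU π (m * k)) ≤
        Module.finrank (MvPolynomial τ ℂ) S * Module.finrank ℂ (restrictTotalDegree τ ℂ (k + c)) ∧
      Module.finrank (MvPolynomial τ ℂ) S * Module.finrank ℂ (restrictTotalDegree τ ℂ k) ≤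
        Module.finrank ℂ (bkU π (m * (k + c))) := by
  classical
  have hfin := bk_finite hA π hs hπ hm f hf nz halg
  obtain ⟨Γ, hΓ, h⟩ := bk_lemmaA hA π hπ hm f hf nz
  have hinj : Function.Injective (algebraMap (MvPolynomial τ ℂ) S) := FaithfulSMul.algebraMap_injective _ _
  obtain ⟨D, hD⟩ : ∃ D, Module.finrank (MvPolynomial τ ℂ) S = D := ⟨_, rfl⟩
  obtain ⟨e, he⟩ := exists_linearIndependent_of_le_finrank (R := MvPolynomial τ ℂ) (M := S) hD.ge
  obtain ⟨a, ha, haΓ⟩ := bk_torsion (MvPolynomial τ ℂ) S D hD e he Γ hΓ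
  rw [hD]
  have h1 : ∀ s ∈ Γ, ∃ c : Fin D → MvPolynomial τ ℂ, ∑ i, c i • e i = a • s := fun s hs =>
    (Submodule.mem_span_range_iff_exists_fun _).1 (haΓ s hs)
  choose! cf hcf using h1
  let c0 := ∑ s ∈ hΓ.toFinset, ∑ i, (cf s i).totalDegree
  have hc0 : ∀ s ∈ Γ, ∀ i, (cf s i).totalDegree ≤ c0 := by
    intro s hs i
    refine le_trans ?_ (Finset.single_le_sum (f := fun s => ∑ i, (cf s i).totalDegree)
      (fun _ _ => Nat.zero_le _) (hΓ.mem_toFinset.2 hs))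
    exact (Finset.single_le_sum (f := fun i => (cf s i).totalDegree)
      (fun _ _ => Nat.zero_le _) (Finset.mem_univ i))
  choose pe hpe using fun i => hs (e i)
  let c1 := ∑ i, (pe i).totalDegree
  have hc1 : ∀ i, (pe i).totalDegree ≤ c1 := fun i => (Finset.single_le_sum (f := fun i => (pe i).totalDegree)
      (fun _ _ => Nat.zero_le _) (Finset.mem_univ i))
  have hfr : ∀ k, Module.finrank ℂ (Fin D → restrictTotalDegree τ ℂ k) =
      D * Module.finrank ℂ (restrictTotalDegree τ ℂ k) := by
    intro k
    rw [Module.finrank_pi_fintype]; simp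
  have hUfin : ∀ j, Module.Finite ℂ (bkU π j) := fun j => by
    unfold bkU; infer_instance
  refine ⟨c0 + c1, fun k => ⟨?_, ?_⟩⟩
  · let g : τ → S := fun i => π (f i)
    rw [← hfr]
    have hle : (bkU π (m * k)).map (LinearMap.mulLeft ℂ (algebraMap _ S a)) ≤
        LinearMap.range (bkΦ D (k + (c0 + c1)) g e) := by
      rintro _ ⟨x, hx, rfl⟩
      obtain ⟨p, hp, rfl⟩ := hx
      have hx := h k p ((mem_restrictTotalDegree _ _ _).1 hp)
      simp only [AlgHom.toLinearMap_apply]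
      generalize π p = x at hx
      induction hx using Submodule.span_induction with
      | mem x h =>
        obtain ⟨b, hb, s, hs, rfl⟩ := h
        refine ⟨fun i => ⟨b * cf s i, ?_⟩, ?_⟩
        · rw [mem_restrictTotalDegree]
          refine (totalDegree_mul _ _).trans ?_
          have := hc0 s hs i
          omega
        · rw [bkΦ_apply, LinearMap.mulLeft_apply]
          have h3 := hcf s hs
          simp only [Algebra.smul_def, halg] at h3
          rw [mul_left_comm, halg, ← h3, Finset.mul_sum]
          refine Finset.sum_congr rfl fun i _ => ?_
          simp only [map_mul, g]; ring
      | zero => simp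
      | add x y _ _ h1 h2 => rw [map_add]; exact add_mem h1 h2
      | smul c x _ h => rw [map_smul]; exact Submodule.smul_mem _ _ h
    calc _ = Module.finrank ℂ ((bkU π (m * k)).map (LinearMap.mulLeft ℂ (algebraMap _ S a))) := by
          refine (Submodule.equivMapOfInjective _ ?_ _).finrank_eq
          exact mul_right_injective₀ (by simpa using hinj.ne ha)
      _ ≤ Module.finrank ℂ (LinearMap.range (bkΦ D (k + (c0 + c1)) g e)) := Submodule.finrank_mono hle
      _ ≤ _ := LinearMap.finrank_range_le _
  · let g : τ → S := fun i => π (f i)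
    rw [← hfr]
    have hle : LinearMap.range (bkΦ D k g e) ≤ bkU π (m * (k + (c0 + c1))) := by
      rintro _ ⟨b, rfl⟩
      rw [bkΦ_apply]
      refine Submodule.sum_mem _ fun i _ => ?_
      refine ⟨aeval f (b i : MvPolynomial τ ℂ) * pe i, ?_, ?_⟩
      · rw [SetLike.mem_coe, mem_restrictTotalDegree]
        refine (totalDegree_mul _ _).trans ?_
        have h1 := bk_totalDegree_aeval f hf (b i : MvPolynomial τ ℂ) k
          ((mem_restrictTotalDegree _ _ _).1 (b i).2)
        have h2 := hc1 i
        have h3 : c1 ≤ m * c1 := Nat.le_mul_of_pos_left _ hm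
        rw [mul_add, mul_add]; omega
      · simp only [AlgHom.toLinearMap_apply, map_mul, hpe]
        congr 1
        have : (aeval g : MvPolynomial τ ℂ →ₐ[ℂ] S) = π.comp (aeval f) := by
          ext i; simp [g]
        rw [this]; rfl
    have hinjΦ : Function.Injective (bkΦ D k g e) := by
      rw [← LinearMap.ker_eq_bot, LinearMap.ker_eq_bot']
      intro b hb
      rw [bkΦ_apply] at hb
      have : ∑ i, (b i : MvPolynomial τ ℂ) • e i = 0 := by
        rw [← hb]
        exact Finset.sum_congr rfl fun i _ => by rw [Algebra.smul_def, halg]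
      have := Fintype.linearIndependent_iff.1 he _ this
      ext1 i
      exact Subtype.ext (this i)
    rw [← LinearMap.finrank_range_of_inj hinjΦ]
    exact Submodule.finrank_mono hle
end

theorem bk_beta (t k : ℕ) : Module.finrank ℂ (restrictTotalDegree (Fin (t + 1)) ℂ k) =
    (k + t + 1).choose (t + 1) := by
  classical
  have h1 : Module.finrank ℂ (restrictTotalDegree (Fin (t + 1)) ℂ k) =
      Nat.card {d : Fin (t + 1) →₀ ℕ | (d.sum fun _ e => e) ≤ k} :=
    Module.finrank_eq_nat_card_basis (basisRestrictSupport ℂ _)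
  have h2 : {d : Fin (t + 1) →₀ ℕ | (d.sum fun _ e => e) ≤ k} =
      ((Finset.range (k + 1)).biUnion fun j => (Finset.univ : Finset (Fin (t + 1))).finsuppAntidiag j : Finset _) := by
    ext d
    simp [Finsupp.sum_fintype]
  rw [h1, h2, Nat.card_eq_card_toFinset]
  rw [Finset.toFinset_coe, Finset.card_biUnion]
  · rw [← Nat.sum_range_add_choose]
    refine Finset.sum_congr rfl fun j _ => ?_
    rw [Finset.card_finsuppAntidiag_nat_eq_choose]
    simp only [Finset.card_univ, Fintype.card_fin]
    rw [show t + 1 + j - 1 = t + j by omega, add_comm t j, Nat.choose_symm_add]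
  · intro i _ j _ hij
    rw [Function.onFun, Finset.disjoint_left]
    intro d hd hd'
    rw [Finset.mem_finsuppAntidiag] at hd hd'
    exact hij (hd.1.symm.trans hd'.1)

open Filter Topology in
theorem bk_choose_tendsto (t a b : ℕ) (ha : 1 ≤ a) :
    Tendsto (fun k : ℕ => ((a * k + b).choose t : ℝ) / (k : ℝ) ^ t) atTop (𝓝 ((a : ℝ) ^ t / t.factorial)) := by
  have h1 := isEquivalent_choose t
  have hsub : Tendsto (fun k : ℕ => a * k + b) atTop atTop :=
    tendsto_atTop_mono (fun k => (Nat.le_mul_of_pos_left k ha).trans (Nat.le_add_right _ b)) tendsto_id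
  have h2 := h1.comp_tendsto hsub
  have hlin : Tendsto (fun k : ℕ => ((a * k + b : ℕ) : ℝ) / (k : ℝ)) atTop (𝓝 (a : ℝ)) := by
    have : Tendsto (fun k : ℕ => (a : ℝ) + (b : ℝ) / (k : ℝ)) atTop (𝓝 ((a : ℝ) + 0)) :=
      tendsto_const_nhds.add (tendsto_const_div_atTop_nhds_zero_nat _)
    rw [add_zero] at this
    refine this.congr' ?_
    filter_upwards [eventually_gt_atTop 0] with k hk
    have : (k : ℝ) ≠ 0 := by positivity
    push_cast; field_simp
  have h3 := (hlin.pow t).div_const (t.factorial : ℝ)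
  have h4 : Asymptotics.IsEquivalent atTop
      (fun k : ℕ => ((a * k + b).choose t : ℝ) / (k : ℝ) ^ t)
      (fun k : ℕ => (((a * k + b : ℕ) : ℝ) / (k : ℝ)) ^ t / t.factorial) := by
    have := h2.div (Asymptotics.IsEquivalent.refl (u := fun k : ℕ => (k : ℝ) ^ t) (l := atTop))
    refine this.congr_right ?_
    filter_upwards with k
    simp only [Pi.div_apply, Function.comp]
    rw [div_pow]; ring
  exact h4.symm.tendsto_nhds h3

open Filter Topology in
theorem bk_compare_le (D D' t t' a a' c : ℕ) (ha : 1 ≤ a) (ha' : 1 ≤ a') (hD : 1 ≤ D)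
    (h : ∀ k : ℕ, D * (a * k + t + 1).choose (t + 1) ≤ D' * (a' * k + c + t' + 1).choose (t' + 1)) :
    t ≤ t' := by
  by_contra hlt
  push Not at hlt
  have h1 := (bk_choose_tendsto (t + 1) a (t + 1) ha).const_mul (D : ℝ)
  have h2 := (bk_choose_tendsto (t' + 1) a' (c + t' + 1) ha').const_mul (D' : ℝ)
  have h3 : Tendsto (fun k : ℕ => (1 : ℝ) / (k : ℝ) ^ (t - t')) atTop (𝓝 0) := by
    have : Tendsto (fun k : ℕ => (k : ℝ) ^ (t - t')) atTop atTop :=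
      (tendsto_pow_atTop (by omega)).comp tendsto_natCast_atTop_atTop
    simpa using! this.inv_tendsto_atTop
  have h4 := h2.mul h3
  rw [mul_zero] at h4
  have := le_of_tendsto_of_tendsto h1 h4 (by
    filter_upwards [eventually_gt_atTop 0] with k hk
    have hk' : (0 : ℝ) < k := by exact_mod_cast hk
    have h5 : (k : ℝ) ^ (t + 1) = (k : ℝ) ^ (t' + 1) * (k : ℝ) ^ (t - t') := by
      rw [← pow_add]; congr 1; omega
    have h6 : (D : ℝ) * ((a * k + t + 1).choose (t + 1) : ℕ) ≤ D' * ((a' * k + c + t' + 1).choose (t' + 1) : ℕ) := by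
      exact_mod_cast h k
    rw [← mul_div_assoc, ← mul_div_assoc (D' : ℝ), div_mul_div_comm, mul_one, ← h5]
    refine div_le_div_of_nonneg_right ?_ (by positivity)
    simpa only [add_assoc] using h6)
  have : (0:ℝ) < D * ((a:ℝ) ^ (t + 1) / (t + 1).factorial) := by positivity
  linarith

open Filter Topology in
theorem bk_compare_le' (D D' t a a' c : ℕ) (ha : 1 ≤ a) (ha' : 1 ≤ a')
    (h : ∀ k : ℕ, D * (a * k + t + 1).choose (t + 1) ≤ D' * (a' * k + c + t + 1).choose (t + 1)) :
    D * a ^ (t + 1) ≤ D' * a' ^ (t + 1) := by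
  have h1 := (bk_choose_tendsto (t + 1) a (t + 1) ha).const_mul (D : ℝ)
  have h2 := (bk_choose_tendsto (t + 1) a' (c + t + 1) ha').const_mul (D' : ℝ)
  have := le_of_tendsto_of_tendsto h1 h2 (by
    filter_upwards [eventually_gt_atTop 0] with k hk
    have h6 : (D : ℝ) * ((a * k + t + 1).choose (t + 1) : ℕ) ≤ D' * ((a' * k + c + t + 1).choose (t + 1) : ℕ) := by
      exact_mod_cast h k
    rw [← mul_div_assoc, ← mul_div_assoc]
    refine div_le_div_of_nonneg_right ?_ (by positivity)
    simpa only [add_assoc] using h6)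
  rw [← mul_div_assoc, ← mul_div_assoc, div_le_div_iff_of_pos_right (by positivity)] at this
  exact_mod_cast this

theorem bk_hilbert {σ S : Type} [Fintype σ] [CommRing S] [IsDomain S] [Algebra ℂ S]
    {A : Set (σ → ℂ)} (hA : BkCone A) (π : MvPolynomial σ ℂ →ₐ[ℂ] S)
    (hs : Function.Surjective π)
    (hπ : ∀ p, π p = 0 ↔ ∀ v ∈ A, eval v p = 0) {m t s : ℕ} (hm : 1 ≤ m)
    (f : Fin (t + 1) → MvPolynomial σ ℂ) (hf : ∀ i, (f i).IsHomogeneous m)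
    (nz : ∀ v ∈ A, ∃ i, eval v (f i) ≠ 0)
    [Algebra (MvPolynomial (Fin (t + 1)) ℂ) S] [FaithfulSMul (MvPolynomial (Fin (t + 1)) ℂ) S]
    (halg : ∀ b : MvPolynomial (Fin (t + 1)) ℂ, algebraMap _ S b = aeval (fun i => π (f i)) b)
    (D : ℕ) (hD : Module.finrank (MvPolynomial (Fin (t + 1)) ℂ) S = D) (hD1 : 1 ≤ D) (D' c' : ℕ)
    (hD1' : 1 ≤ D')
    (h1 : ∀ k, Module.finrank ℂ (bkU π k) ≤ D' * (k + c' + s + 1).choose (s + 1))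
    (h2 : ∀ k, D' * (k + s + 1).choose (s + 1) ≤ Module.finrank ℂ (bkU π (k + c'))) :
    t = s ∧ D = D' * m ^ (t + 1) := by
  obtain ⟨c, hc⟩ := bk_lemmaC hA π hs hπ hm f hf nz halg
  simp only [bk_beta, hD] at hc
  have i1 : ∀ k, D * (1 * k + t + 1).choose (t + 1) ≤ D' * (m * k + (m * c + c') + s + 1).choose (s + 1) := by
    intro k
    have := (hc k).2.trans (h1 _)
    rw [one_mul, show m * k + (m * c + c') = m * (k + c) + c' by ring]
    exact this
  have i2 : ∀ k, D' * (m * k + s + 1).choose (s + 1) ≤ D * (1 * k + (c + c') + t + 1).choose (t + 1) := by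
    intro k
    refine (h2 _).trans (le_trans ?_ ((hc (k + c')).1.trans (le_of_eq ?_)))
    · have : Module.Finite ℂ (bkU π (m * (k + c'))) := by unfold bkU; infer_instance
      refine Submodule.finrank_mono (Submodule.map_mono fun p hp => ?_)
      rw [mem_restrictTotalDegree] at hp ⊢
      refine hp.trans ?_
      rw [mul_add]
      have := Nat.le_mul_of_pos_left c' hm
      omega
    · congr 2; ring
  have e : t = s := le_antisymm (bk_compare_le D D' t s 1 m _ le_rfl hm hD1 i1)
    (bk_compare_le D' D s t m 1 _ hm le_rfl hD1' i2)
  subst e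
  refine ⟨rfl, le_antisymm ?_ ?_⟩
  · simpa using bk_compare_le' D D' t 1 m _ le_rfl hm i1
  · simpa using bk_compare_le' D' D t m 1 _ hm le_rfl i2

theorem bk_norm {σ : Type} {A : Set (σ → ℂ)} (hA : BkCone A) {m : ℕ} (hm : 1 ≤ m)
    (V : Submodule ℂ (MvPolynomial σ ℂ)) (hV : ∀ p ∈ V, p.IsHomogeneous m)
    (T : Set (σ → ℂ)) (hTA : T ⊆ A) (hT : T.Nonempty) :
    ∀ (s : ℕ) (f : Fin (s + 1) → MvPolynomial σ ℂ), (∀ i, f i ∈ V) →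
      (∀ v ∈ A, ∃ i, eval v (f i) ≠ 0) →
      (∀ v ∈ T, eval v (f 0) = 1 ∧ ∀ j, j ≠ 0 → eval v (f j) = 0) →
    ∃ (t : ℕ) (g : Fin (t + 1) → MvPolynomial σ ℂ), (∀ i, g i ∈ V) ∧
      (∀ v ∈ A, ∃ i, eval v (g i) ≠ 0) ∧
      (∀ v ∈ T, eval v (g 0) = 1 ∧ ∀ j, j ≠ 0 → eval v (g j) = 0) ∧
      (∀ F : MvPolynomial (Fin (t + 1)) ℂ, (∀ v ∈ A, eval (fun i => eval v (g i)) F = 0) → F = 0) := by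
  intro s
  induction s with
  | zero =>
    intro f hfV nz hfT
    refine ⟨0, f, hfV, nz, hfT, fun F hF => ?_⟩
    have key : ∀ k, homogeneousComponent k F = 0 := by
      intro k
      have h1 := bk_hom_vanish ((fun v i => eval v (f i)) '' A) (by
        rintro _ ⟨v, hv, rfl⟩ c hc
        obtain ⟨z, hz⟩ := IsAlgClosed.exists_pow_nat_eq c (n := m) hm
        have hz0 : z ≠ 0 := by rintro rfl; exact hc (by rw [← hz, zero_pow (by omega)])
        refine ⟨z • v, hA.smul v hv z hz0, ?_⟩
        funext i
        simp only [Pi.smul_apply, smul_eq_mul]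
        rw [bk_eval_smul (hV _ (hfV i)), hz]) F (by rintro _ ⟨v, hv, rfl⟩; exact hF v hv) k
      obtain ⟨v0, hv0⟩ := hT
      have h2 := h1 _ ⟨v0, hTA hv0, rfl⟩
      have h3 : (fun i => eval v0 (f i)) = fun _ => 1 := by
        funext i
        rw [show i = 0 from Fin.fin_one_eq_zero i]; exact (hfT v0 hv0).1
      simp only [h3] at h2
      refine MvPolynomial.funext fun w => ?_
      have h4 : w = w 0 • (fun _ => 1 : Fin 1 → ℂ) := by
        funext i
        rw [show i = 0 from Fin.fin_one_eq_zero i]; simp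
      rw [h4, bk_eval_smul (homogeneousComponent_isHomogeneous k F), h2]; simp
    rw [← sum_homogeneousComponent F]
    exact Finset.sum_eq_zero fun k _ => key k
  | succ s ih =>
    intro f hfV nz hfT
    by_cases hind : ∀ F : MvPolynomial (Fin (s + 1 + 1)) ℂ, (∀ v ∈ A, eval (fun i => eval v (f i)) F = 0) → F = 0
    · exact ⟨s + 1, f, hfV, nz, hfT, hind⟩
    push Not at hind
    obtain ⟨F, hF, hF0⟩ := hind
    obtain ⟨k, hk⟩ : ∃ k, homogeneousComponent k F ≠ 0 := by
      by_contra hcon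
      push Not at hcon
      apply hF0
      rw [← sum_homogeneousComponent F]
      exact Finset.sum_eq_zero fun k _ => hcon k
    have h1 := bk_hom_vanish ((fun v i => eval v (f i)) '' A) (by
      rintro _ ⟨v, hv, rfl⟩ c hc
      obtain ⟨z, hz⟩ := IsAlgClosed.exists_pow_nat_eq c (n := m) hm
      have hz0 : z ≠ 0 := by rintro rfl; exact hc (by rw [← hz, zero_pow (by omega)])
      refine ⟨z • v, hA.smul v hv z hz0, ?_⟩
      funext i
      simp only [Pi.smul_apply, smul_eq_mul]
      rw [bk_eval_smul (hV _ (hfV i)), hz]) F (by rintro _ ⟨v, hv, rfl⟩; exact hF v hv) k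
    have hFk := homogeneousComponent_isHomogeneous k F
    set P := homogeneousComponent k F with hP
    obtain ⟨c, hc⟩ : ∃ c, eval c (P * X (Fin.last (s + 1))) ≠ 0 := by
      by_contra hcon
      push Not at hcon
      have : P * X (Fin.last (s + 1)) = 0 := MvPolynomial.funext fun w => by rw [hcon w]; simp
      rcases mul_eq_zero.1 this with h | h
      · exact hk h
      · exact X_ne_zero _ h
    rw [map_mul, eval_X] at hc
    have hcP := left_ne_zero_of_mul hc
    have hcl := right_ne_zero_of_mul hc
    let c' := (c (Fin.last (s + 1)))⁻¹ • c
    have hc'P : eval c' P ≠ 0 := by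
      rw [bk_eval_smul hFk]
      exact mul_ne_zero (pow_ne_zero _ (inv_ne_zero hcl)) hcP
    have hc'l : c' (Fin.last (s + 1)) = 1 := by simp [c', hcl]
    let g : Fin (s + 1) → MvPolynomial σ ℂ := fun i => f i.castSucc - c' i.castSucc • f (Fin.last (s + 1))
    refine ih g (fun i => V.sub_mem (hfV _) (V.smul_mem _ (hfV _))) ?_ ?_
    · intro v hv
      by_contra hcon
      push Not at hcon
      have h2 : (fun i => eval v (f i)) = (eval v (f (Fin.last (s + 1)))) • c' := by
        funext i
        refine Fin.lastCases ?_ (fun i => ?_) i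
        · simp [hc'l]
        · have := hcon i
          simp only [g, map_sub, smul_eval, sub_eq_zero] at this
          rw [this]; simp [mul_comm]
      have h3 := h1 _ ⟨v, hv, rfl⟩
      simp only [h2] at h3
      rw [bk_eval_smul hFk] at h3
      have h4 : eval v (f (Fin.last (s + 1))) = 0 := by
        rcases mul_eq_zero.1 h3 with h | h
        · exact eq_zero_of_pow_eq_zero h
        · exact absurd h hc'P
      obtain ⟨i, hi⟩ := nz v hv
      apply hi
      have := congrFun h2 i
      simpa [h4] using this
    · intro v hv
      have hl : eval v (f (Fin.last (s + 1))) = 0 := (hfT v hv).2 _ (Fin.last_pos.ne')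
      refine ⟨?_, fun j hj => ?_⟩
      · simp [g, hl, (hfT v hv).1]
      · have : eval v (f j.castSucc) = 0 := (hfT v hv).2 _ (fun h0 => hj (Fin.castSucc_injective _ (h0.trans Fin.castSucc_zero.symm)))
        simp [g, hl, this]

structure BkSys {σ : Type} (A : Set (σ → ℂ)) (m : ℕ) {t : ℕ} (f : Fin (t + 1) → MvPolynomial σ ℂ) :
    Prop where
  hom : ∀ i, (f i).IsHomogeneous m
  nz : ∀ v ∈ A, ∃ i, eval v (f i) ≠ 0
  indep : ∀ F : MvPolynomial (Fin (t + 1)) ℂ, (∀ v ∈ A, eval (fun i => eval v (f i)) F = 0) → F = 0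

@[reducible] noncomputable def bkAlg {S τ : Type} [CommRing S] [Algebra ℂ S] (g : τ → S) :
    Algebra (MvPolynomial τ ℂ) S := (aeval g).toRingHom.toAlgebra

noncomputable def bkD {S τ : Type} [CommRing S] [Algebra ℂ S] (g : τ → S) : ℕ :=
  @Module.finrank (MvPolynomial τ ℂ) S _ _ (bkAlg g).toModule

theorem bkAlg_faithful {σ S : Type} [CommRing S] [Algebra ℂ S]
    {A : Set (σ → ℂ)} (π : MvPolynomial σ ℂ →ₐ[ℂ] S)
    (hπ : ∀ p, π p = 0 ↔ ∀ v ∈ A, eval v p = 0) {m t : ℕ} 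
    {f : Fin (t + 1) → MvPolynomial σ ℂ} (hf : BkSys A m f) :
    let _ := bkAlg (fun i => π (f i)); FaithfulSMul (MvPolynomial (Fin (t + 1)) ℂ) S := by
  let _ := bkAlg (fun i => π (f i))
  rw [faithfulSMul_iff_algebraMap_injective, injective_iff_map_eq_zero]
  intro F hF
  refine hf.indep F fun v hv => ?_
  have h1 : aeval (fun i => π (f i)) F = π (aeval f F) := by
    have : (aeval (fun i => π (f i)) : MvPolynomial (Fin (t + 1)) ℂ →ₐ[ℂ] S) = π.comp (aeval f) := by
      ext i; simp
    rw [this]; rfl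
  have h2 : π (aeval f F) = 0 := by rw [← h1]; exact hF
  have h3 := (hπ _).1 h2 v hv
  rw [← h3, ← aeval_eq_eval, ← aeval_eq_eval]
  have : (aeval (fun i => aeval v (f i)) : MvPolynomial (Fin (t + 1)) ℂ →ₐ[ℂ] ℂ) = (aeval v).comp (aeval f) := by
    ext i; simp
  exact congrArg (fun φ => φ F) this

theorem bkD_pos {σ S : Type} [Fintype σ] [CommRing S] [IsDomain S] [Algebra ℂ S]
    {A : Set (σ → ℂ)} (hA : BkCone A) (π : MvPolynomial σ ℂ →ₐ[ℂ] S)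
    (hs : Function.Surjective π)
    (hπ : ∀ p, π p = 0 ↔ ∀ v ∈ A, eval v p = 0) {m t : ℕ} (hm : 1 ≤ m)
    {f : Fin (t + 1) → MvPolynomial σ ℂ} (hf : BkSys A m f) : 1 ≤ bkD (fun i => π (f i)) := by
  let _ := bkAlg (fun i => π (f i))
  have h1 := bkAlg_faithful π hπ hf
  have := bk_finite hA π hs hπ hm f hf.hom hf.nz (fun b => rfl)
  have : Module.IsTorsionFree (MvPolynomial (Fin (t + 1)) ℂ) S := inferInstance
  exact Module.finrank_pos

theorem bk_ratio {σ S : Type} [Fintype σ] [CommRing S] [IsDomain S] [Algebra ℂ S]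
    {A : Set (σ → ℂ)} (hA : BkCone A) (π : MvPolynomial σ ℂ →ₐ[ℂ] S)
    (hs : Function.Surjective π)
    (hπ : ∀ p, π p = 0 ↔ ∀ v ∈ A, eval v p = 0) {m t s : ℕ} (hm : 1 ≤ m)
    {f : Fin (t + 1) → MvPolynomial σ ℂ} (hf : BkSys A m f)
    {y : Fin (s + 1) → MvPolynomial σ ℂ} (hy : BkSys A 1 y) :
    bkD (fun i => π (f i)) = bkD (fun i => π (y i)) * m ^ (t + 1) := by
  obtain ⟨c', h12⟩ : ∃ c', ∀ k, Module.finrank ℂ (bkU π k) ≤ bkD (fun i => π (y i)) * (k + c' + s + 1).choose (s + 1) ∧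
      bkD (fun i => π (y i)) * (k + s + 1).choose (s + 1) ≤ Module.finrank ℂ (bkU π (k + c')) := by
    let _ := bkAlg (fun i => π (y i))
    have h1 := bkAlg_faithful π hπ hy
    have := bk_lemmaC hA π hs hπ (le_refl 1) y hy.hom hy.nz (fun b => rfl)
    obtain ⟨c, hc⟩ := this
    refine ⟨c, fun k => ?_⟩
    have h2 := hc k
    rw [one_mul, one_mul, bk_beta, bk_beta] at h2
    exact h2
  have p1 := bkD_pos hA π hs hπ hm hf
  have p2 := bkD_pos hA π hs hπ le_rfl hy
  let _ := bkAlg (fun i => π (f i))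
  have h1 := bkAlg_faithful π hπ hf
  exact (bk_hilbert hA π hs hπ hm f hf.hom hf.nz (fun b => rfl) (bkD (fun i => π (f i))) rfl p1 _ c' p2
    (fun k => (h12 k).1) (fun k => (h12 k).2)).2

noncomputable def bkLin {σ : Type} [Fintype σ] [DecidableEq σ] (l : Module.Dual ℂ (σ → ℂ)) : MvPolynomial σ ℂ :=
  ∑ i, C (l (Pi.single i 1)) * X i

theorem bkLin_eval {σ : Type} [Fintype σ] [DecidableEq σ] (l : Module.Dual ℂ (σ → ℂ)) (v : σ → ℂ) :
    eval v (bkLin l) = l v := by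
  conv_rhs => rw [pi_eq_sum_univ' v]
  simp [bkLin, map_sum, mul_comm]

theorem bkLin_hom {σ : Type} [Fintype σ] [DecidableEq σ] (l : Module.Dual ℂ (σ → ℂ)) :
    (bkLin l).IsHomogeneous 1 :=
  IsHomogeneous.sum _ _ _ fun i _ => by
    simpa using (isHomogeneous_C σ (l (Pi.single i 1))).mul (isHomogeneous_X ℂ i)

theorem bk_separate {σ : Type} [Fintype σ] [DecidableEq σ] (T : Finset (σ → ℂ)) :
    ∃ p : MvPolynomial σ ℂ, Set.InjOn (fun v => eval v p) (T : Set (σ → ℂ)) := by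
  let ι := {q : T × T // q.1 ≠ q.2}
  obtain ⟨l, hl⟩ := Module.exists_dual_forall_apply_ne_zero (K := ℂ) (M := σ → ℂ)
    (fun q : ι => (q.1.1 : σ → ℂ) - q.1.2) (fun q => by
      rw [sub_ne_zero]
      exact fun h => q.2 (Subtype.ext h))
  refine ⟨bkLin l, fun v hv w hw h => ?_⟩
  by_contra hne
  have := hl ⟨(⟨v, hv⟩, ⟨w, hw⟩), fun h' => hne (congrArg Subtype.val h')⟩
  apply this
  simp only [bkLin_eval] at h
  simp [h]

section
variable {σ S : Type} [Fintype σ] [CommRing S] [IsDomain S] [Algebra ℂ S]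
    {A : Set (σ → ℂ)} (hA : BkCone A) (π : MvPolynomial σ ℂ →ₐ[ℂ] S)
    (hs : Function.Surjective π)
    (hπ : ∀ p, π p = 0 ↔ ∀ v ∈ A, eval v p = 0) {m t : ℕ} (hm : 1 ≤ m)
    {y : Fin (t + 1) → MvPolynomial σ ℂ} (hy : BkSys A m y)

omit [Fintype σ] [IsDomain S] in
include hs hπ in
theorem bk_evhom (v : σ → ℂ) (hv : v ∈ A) : ∃ ε : S →ₐ[ℂ] ℂ, ∀ p, ε (π p) = eval v p := by
  refine ⟨AlgHom.liftOfSurjective π hs (aeval v) ?_, fun p => ?_⟩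
  · intro p hp
    have := (hπ p).1 hp v hv
    simpa using this
  · rw [AlgHom.liftOfSurjective_apply]; simp

include hA hs hπ hm hy

theorem bk_integral_point (p : MvPolynomial σ ℂ) (a : Fin (t + 1) → ℂ) :
    ∃ r : Polynomial ℂ, r ≠ 0 ∧ r.natDegree ≤ bkD (fun i => π (y i)) ∧
      ∀ v ∈ A, (∀ i, eval v (y i) = a i) → r.IsRoot (eval v p) := by
  let _ := bkAlg (fun i => π (y i))
  have h1 := bkAlg_faithful π hπ hy
  have h2 := bk_finite hA π hs hπ hm y hy.hom hy.nz (fun b => rfl)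
  obtain ⟨f, hf, hfd, hf0⟩ := bk_minpoly_bound (MvPolynomial (Fin (t + 1)) ℂ) S (π p)
  refine ⟨f.map (eval a), (hf.map _).ne_zero, (Polynomial.natDegree_map_le).trans hfd, fun v hv hva => ?_⟩
  obtain ⟨ε, hε⟩ := bk_evhom π hs hπ v hv
  have h3 : (ε : S →+* ℂ).comp (algebraMap (MvPolynomial (Fin (t + 1)) ℂ) S) = eval a := by
    refine MvPolynomial.ringHom_ext (fun c => ?_) (fun i => ?_)
    · change ε (aeval _ (C c)) = _
      simp
    · change ε (aeval _ (X i)) = _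
      simp [hε, hva]
  have h4 := congrArg (ε : S →+* ℂ) hf0
  rw [Polynomial.aeval_def, Polynomial.hom_eval₂, h3] at h4
  rw [Polynomial.IsRoot, Polynomial.eval_map, ← hε]
  simpa using h4

theorem bk_fibre_upper (T : Finset (σ → ℂ)) (hT : ∀ v ∈ T, v ∈ A) (a : Fin (t + 1) → ℂ)
    (ha : ∀ v ∈ T, ∀ i, eval v (y i) = a i) : T.card ≤ bkD (fun i => π (y i)) := by
  classical
  obtain ⟨p, hp⟩ := bk_separate T
  obtain ⟨r, hr0, hrd, hr⟩ := bk_integral_point hA π hs hπ hm hy p a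
  rw [← Finset.card_image_of_injOn hp]
  have : T.image (fun v => eval v p) ⊆ r.roots.toFinset := by
    intro z hz
    obtain ⟨v, hv, rfl⟩ := Finset.mem_image.1 hz
    rw [Multiset.mem_toFinset, Polynomial.mem_roots hr0]
    exact hr v (hT v hv) (ha v hv)
  exact (Finset.card_le_card this).trans ((Multiset.toFinset_card_le _).trans
    ((Polynomial.card_roots' r).trans hrd))

theorem bk_fibre_finite (a : Fin (t + 1) → ℂ) :
    {v | v ∈ A ∧ ∀ i, eval v (y i) = a i}.Finite := by
  choose r hr0 _ hr using fun j : σ => bk_integral_point hA π hs hπ hm hy (X j) a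
  refine Set.Finite.subset (Set.Finite.pi' (t := fun j => {z | (r j).IsRoot z})
    (fun j => Polynomial.finite_setOfPred_isRoot (hr0 j))) ?_
  rintro v ⟨hv, hva⟩ j
  simpa using hr j v hv hva

theorem bk_fibre_lower : ∃ a : Fin (t + 1) → ℂ, a ≠ 0 ∧
    bkD (fun i => π (y i)) ≤ {v | v ∈ A ∧ ∀ i, eval v (y i) = a i}.ncard := by
  classical
  have hfin := bk_fibre_finite hA π hs hπ hm hy
  let _ := bkAlg (fun i => π (y i))
  have h1 := bkAlg_faithful π hπ hy
  have h2 := bk_finite hA π hs hπ hm y hy.hom hy.nz (fun b => rfl)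
  have : CharZero (MvPolynomial (Fin (t + 1)) ℂ) := inferInstance
  obtain ⟨θ, b, hb, hφ⟩ := bk_fibre (MvPolynomial (Fin (t + 1)) ℂ) S
  obtain ⟨a, ha⟩ : ∃ a, eval a (b * X 0) ≠ 0 := by
    by_contra hcon
    push Not at hcon
    have : b * X 0 = 0 := MvPolynomial.funext fun w => by rw [hcon w]; simp
    rcases mul_eq_zero.1 this with h | h
    · exact hb h
    · exact X_ne_zero _ h
  rw [map_mul, eval_X] at ha
  obtain ⟨R, hR, hRψ⟩ := hφ (eval a) (left_ne_zero_of_mul ha)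
  have ha0 : a ≠ 0 := fun h => right_ne_zero_of_mul ha (by simp [h])
  obtain ⟨p, rfl⟩ := hs θ
  refine ⟨a, ha0, ?_⟩
  have hpt : ∀ r ∈ R, ∃ v, (v ∈ A ∧ ∀ i, eval v (y i) = a i) ∧ eval v p = r := by
    intro r hr
    obtain ⟨ψ, hψ, hψr⟩ := hRψ r hr
    let v : σ → ℂ := fun j => ψ (π (X j))
    have hC : ∀ c : ℂ, ψ (π (C c)) = c := by
      intro c
      have h3 := congrArg (fun g => g (C c)) hψ
      simp only [RingHom.comp_apply, eval_C] at h3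
      have h4 : algebraMap (MvPolynomial (Fin (t + 1)) ℂ) S (C c) = π (C c) := by
        change aeval _ (C c) = _
        rw [aeval_C, ← MvPolynomial.algebraMap_eq, AlgHom.commutes]
      rw [← h4]; exact h3
    have hv : ψ.comp (π : MvPolynomial σ ℂ →+* S) = eval v := by
      refine MvPolynomial.ringHom_ext (fun c => ?_) (fun i => ?_)
      · simpa using hC c
      · simp [v]
    have hv' : ∀ q, eval v q = ψ (π q) := fun q => by rw [← hv]; rfl
    have hva : ∀ i, eval v (y i) = a i := by
      intro i
      have h3 := congrArg (fun g => g (X i)) hψ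
      simp only [RingHom.comp_apply, eval_X] at h3
      have h4 : algebraMap (MvPolynomial (Fin (t + 1)) ℂ) S (X i) = π (y i) := by
        change aeval _ (X i) = _
        rw [aeval_X]
      rw [hv', ← h4, h3]
    refine ⟨v, ⟨hA.closed v ?_ fun q hq => ?_, hva⟩, by rw [hv', hψr]⟩
    · intro h0
      apply ha0
      funext i
      rw [← hva i, h0]
      have := bk_eval_smul (hy.hom i) 0 0
      rw [zero_pow (by omega), zero_mul, smul_zero] at this
      simpa using this
    · rw [hv', (hπ q).2 hq, map_zero]
  choose! w hw hwp using hpt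
  have hle : ((R.image w : Finset _) : Set (σ → ℂ)) ⊆ {v | v ∈ A ∧ ∀ i, eval v (y i) = a i} := by
    intro v hv
    obtain ⟨r, hr, rfl⟩ := Finset.mem_image.1 hv
    exact hw r hr
  have hcard : (R.image w).card = R.card :=
    Finset.card_image_of_injOn fun r hr r' hr' h => by rw [← hwp r hr, ← hwp r' hr', h]
  calc bkD (fun i => π (y i)) = R.card := hR.symm
    _ = (R.image w).card := hcard.symm
    _ = ((R.image w : Finset _) : Set (σ → ℂ)).ncard := (Set.ncard_coe_finset _).symm
    _ ≤ _ := Set.ncard_le_ncard hle (hfin a)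
end

theorem bk_mem_cone {n : ℕ} {X : Set (Pn n)} {x : Pn n} (v : Fin (n + 1) → ℂ) (hv : v ≠ 0)
    (hx : Projectivization.mk ℂ v hv = x) : v ∈ cone n X ↔ x ∈ X := by
  subst hx
  exact ⟨fun ⟨_, h⟩ => h, fun h => ⟨hv, h⟩⟩

theorem bk_rep_mem {n : ℕ} {X : Set (Pn n)} {x : Pn n} : x.rep ∈ cone n X ↔ x ∈ X :=
  bk_mem_cone _ x.rep_nonzero x.mk_rep

theorem bk_eval_rep {n : ℕ} (v : Fin (n + 1) → ℂ) (hv : v ≠ 0) (p : MvPolynomial (Fin (n + 1)) ℂ)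
    {k : ℕ} (hp : p.IsHomogeneous k) :
    eval (Projectivization.mk ℂ v hv).rep p = 0 ↔ eval v p = 0 := by
  obtain ⟨a, ha⟩ := Projectivization.exists_smul_eq_mk_rep ℂ v hv
  have ha' : (a : ℂ) • v = (Projectivization.mk ℂ v hv).rep := ha
  rw [← ha', bk_eval_smul hp]
  simp

theorem bk_cone_smul {n : ℕ} (X : Set (Pn n)) (v : Fin (n + 1) → ℂ) (hv : v ∈ cone n X) (c : ℂ) (hc : c ≠ 0) :
    c • v ∈ cone n X := by
  obtain ⟨h0, hx⟩ := hv
  refine ⟨smul_ne_zero hc h0, ?_⟩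
  convert hx using 1
  rw [Projectivization.mk_eq_mk_iff']
  exact ⟨c, rfl⟩

theorem bk_isCone {n : ℕ} (X : Set (Pn n)) (hX : IsProjectiveVariety n X) (hne : X.Nonempty) :
    BkCone (cone n X) where
  ne_zero v hv := hv.1
  smul := bk_cone_smul X
  closed v hv h := by
    obtain ⟨⟨P, hP, hXP⟩, _⟩ := hX
    refine ⟨hv, ?_⟩
    rw [hXP]
    intro p hp
    obtain ⟨k, hk⟩ := hP p hp
    rw [bk_eval_rep v hv p hk]
    refine h p fun w hw => ?_
    obtain ⟨hw0, hwX⟩ := hw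
    rw [hXP] at hwX
    exact (bk_eval_rep w hw0 p hk).1 (hwX p hp)
  nonempty := by
    obtain ⟨x, hx⟩ := hne
    exact ⟨x.rep, bk_rep_mem.2 hx⟩

theorem bk_eval_add {σ : Type} {p : MvPolynomial σ ℂ} (hp : p.IsHomogeneous 1) (v w : σ → ℂ) :
    eval (v + w) p = eval v p + eval w p := by
  have hp' : p ∈ homogeneousSubmodule σ ℂ 1 := hp
  rw [homogeneousSubmodule_one_eq_span_X] at hp'
  induction hp' using Submodule.span_induction with
  | mem x h => obtain ⟨i, rfl⟩ := h; simp
  | zero => simp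
  | add x y hx hy h1 h2 =>
    rw [← homogeneousSubmodule_one_eq_span_X] at hx hy
    simp only [map_add, h1 hx, h2 hy]; ring
  | smul c x hx h =>
    rw [← homogeneousSubmodule_one_eq_span_X] at hx
    simp only [smul_eval, h hx]; ring

theorem bk_mk_smul {n : ℕ} (x : Pn n) (c : ℂ) (hc : c • x.rep ≠ 0) : Projectivization.mk ℂ (c • x.rep) hc = x := by
  conv_rhs => rw [← x.mk_rep]
  rw [Projectivization.mk_eq_mk_iff']
  exact ⟨c, rfl⟩

theorem bk_degree {n : ℕ} (X : Set (Pn n)) (hX : IsProjectiveVariety n X) (hne : X.Nonempty)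
    (d : ℕ) (hd : IsDegree n X d) {S : Type} [CommRing S] [IsDomain S] [Algebra ℂ S]
    (π : MvPolynomial (Fin (n + 1)) ℂ →ₐ[ℂ] S)
    (hs : Function.Surjective π)
    (hπ : ∀ p, π p = 0 ↔ ∀ v ∈ cone n X, eval v p = 0) :
    ∃ (s : ℕ) (y : Fin (s + 1) → MvPolynomial (Fin (n + 1)) ℂ), BkSys (cone n X) 1 y ∧
      bkD (fun i => π (y i)) = d := by
  classical
  have hA := bk_isCone X hX hne
  obtain ⟨⟨W, hWfin, hWd⟩, hmax⟩ := hd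
  have hd1 : 1 ≤ d := by
    obtain ⟨x, hx⟩ := hne
    apply hmax
    have : X ∩ {z | z.rep ∈ Submodule.span ℂ {x.rep}} = {x} := by
      ext z
      constructor
      · rintro ⟨_, hz⟩
        obtain ⟨c, hc⟩ := Submodule.mem_span_singleton.1 hz
        have h1 : c • x.rep ≠ 0 := by rw [hc]; exact z.rep_nonzero
        rw [Set.mem_singleton_iff, ← bk_mk_smul x c h1, ← z.mk_rep]
        simp only [hc]
      · rintro rfl
        exact ⟨hx, Submodule.mem_span_singleton_self _⟩
    exact ⟨Submodule.span ℂ {x.rep}, by rw [this]; simp, by rw [this]; simp⟩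
  let F := hWfin.toFinset
  have hFcard : F.card = d := by rw [← hWd, Set.ncard_eq_toFinset_card _ hWfin]
  obtain ⟨l0, hl0⟩ := Module.exists_dual_forall_apply_ne_zero (K := ℂ) (M := Fin (n + 1) → ℂ)
    (fun x : F => (x : Pn n).rep) (fun x => x.1.rep_nonzero)
  have hl0' : ∀ x ∈ F, l0 x.rep ≠ 0 := fun x hx => hl0 ⟨x, hx⟩
  let τ : Pn n → (Fin (n + 1) → ℂ) := fun x => (l0 x.rep)⁻¹ • x.rep
  let T := F.image τ
  have hτ0 : ∀ x ∈ F, τ x ≠ 0 := fun x hx => smul_ne_zero (inv_ne_zero (hl0' x hx)) x.rep_nonzero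
  have hτinj : Set.InjOn τ (F : Set (Pn n)) := by
    intro x hx x' hx' h
    rw [← bk_mk_smul x _ (hτ0 x hx), ← bk_mk_smul x' _ (hτ0 x' hx')]
    simp only [τ] at h
    simp only [h]
  have hTcard : T.card = d := by rw [Finset.card_image_of_injOn hτinj, hFcard]
  have hTA : ∀ v ∈ T, v ∈ cone n X := by
    intro v hv
    obtain ⟨x, hx, rfl⟩ := Finset.mem_image.1 hv
    have : x ∈ X := (hWfin.mem_toFinset.1 hx).1
    exact bk_cone_smul X _ (bk_rep_mem.2 this) _ (inv_ne_zero (hl0' x hx))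
  have hTW : ∀ v ∈ T, v ∈ W := by
    intro v hv
    obtain ⟨x, hx, rfl⟩ := Finset.mem_image.1 hv
    exact W.smul_mem _ (hWfin.mem_toFinset.1 hx).2
  have hTl : ∀ v ∈ T, l0 v = 1 := by
    intro v hv
    obtain ⟨x, hx, rfl⟩ := Finset.mem_image.1 hv
    simp [τ, hl0' x hx]
  have hTne : T.Nonempty := by rw [← Finset.card_pos, hTcard]; omega
  let bs := Module.finBasis ℂ W.dualAnnihilator
  let f : Fin (Module.finrank ℂ W.dualAnnihilator + 1) → MvPolynomial (Fin (n + 1)) ℂ :=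
    Fin.cons (bkLin l0) (fun j => bkLin (bs j : Module.Dual ℂ (Fin (n + 1) → ℂ)))
  have hcut : ∀ v, (∀ j, (bs j : Module.Dual ℂ (Fin (n + 1) → ℂ)) v = 0) → v ∈ W := by
    intro v hv
    rw [← Subspace.forall_mem_dualAnnihilator_apply_eq_zero_iff]
    intro φ hφ
    have h1 := bs.sum_repr ⟨φ, hφ⟩
    have h2 := congrArg (fun z : W.dualAnnihilator => (z : Module.Dual ℂ (Fin (n + 1) → ℂ)) v) h1
    simp only at h2
    rw [← h2, Submodule.coe_sum, LinearMap.sum_apply]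
    exact Finset.sum_eq_zero fun j _ => by simp [hv j]
  obtain ⟨t, y, hyV, hynz, hyT, hyind⟩ := bk_norm hA (le_refl 1) (homogeneousSubmodule (Fin (n + 1)) ℂ 1)
    (fun p hp => hp) (T : Set (Fin (n + 1) → ℂ)) (fun v hv => hTA v hv) hTne _ f (fun i => by
      refine Fin.cases ?_ (fun j => ?_) i
      · exact bkLin_hom _
      · exact bkLin_hom _) (fun v hv => by
      by_contra hcon
      push Not at hcon
      have h0 : l0 v = 0 := by simpa [f, bkLin_eval] using hcon 0
      have h1 : v ∈ W := hcut v fun j => by simpa [f, bkLin_eval] using hcon j.succ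
      obtain ⟨hv0, hvX⟩ := hv
      obtain ⟨a, ha⟩ := Projectivization.exists_smul_eq_mk_rep ℂ v hv0
      have ha' : (a : ℂ) • v = (Projectivization.mk ℂ v hv0).rep := ha
      refine hl0' (Projectivization.mk ℂ v hv0) (hWfin.mem_toFinset.2 ⟨hvX, ?_⟩) ?_
      · change (Projectivization.mk ℂ v hv0).rep ∈ W
        rw [← ha']; exact W.smul_mem _ h1
      · rw [← ha', map_smul, h0, smul_zero]) (fun v hv => by
      refine ⟨by simpa [f, bkLin_eval] using hTl v hv, fun j => ?_⟩
      refine Fin.cases (fun h => absurd rfl h) (fun j _ => ?_) j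
      simp only [f, Fin.cons_succ, bkLin_eval]
      exact (Submodule.mem_dualAnnihilator _).1 (bs j).2 v (hTW v hv))
  have hy : BkSys (cone n X) 1 y := ⟨hyV, hynz, hyind⟩
  refine ⟨t, y, hy, le_antisymm ?_ ?_⟩
  · obtain ⟨a, ha0, hle⟩ := bk_fibre_lower hA π hs hπ (le_refl 1) hy
    have hfin := bk_fibre_finite hA π hs hπ (le_refl 1) hy a
    let W' : Submodule ℂ (Fin (n + 1) → ℂ) :=
      { carrier := {v | ∃ c : ℂ, ∀ i, eval v (y i) = c * a i}
        add_mem' := by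
          rintro v w ⟨c, hc⟩ ⟨c', hc'⟩
          refine ⟨c + c', fun i => ?_⟩
          rw [bk_eval_add (hyV i), hc, hc']; ring
        zero_mem' := ⟨0, fun i => by
          have := bk_eval_smul (hyV i) 0 0
          simpa using this⟩
        smul_mem' := by
          rintro b v ⟨c, hc⟩
          exact ⟨b * c, fun i => by rw [bk_eval_smul (hyV i), hc]; ring⟩ }
    have hbij : Set.BijOn (fun v => if h : v ≠ 0 then Projectivization.mk ℂ v h else hne.some)
        {v | v ∈ cone n X ∧ ∀ i, eval v (y i) = a i} (X ∩ {x | x.rep ∈ W'}) := by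
      refine ⟨?_, ?_, ?_⟩
      · rintro v ⟨hv, hva⟩
        have hv0 := hv.1
        simp only [hv0, ne_eq, not_false_eq_true, dif_pos]
        refine ⟨hv.2, ?_⟩
        obtain ⟨b, hb⟩ := Projectivization.exists_smul_eq_mk_rep ℂ v hv0
        have hb' : (b : ℂ) • v = (Projectivization.mk ℂ v hv0).rep := hb
        change (Projectivization.mk ℂ v hv0).rep ∈ W'
        rw [← hb']
        refine W'.smul_mem _ ⟨1, fun i => by rw [hva i, one_mul]⟩
      · rintro v ⟨hv, hva⟩ w ⟨hw, hwa⟩ h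
        have hv0 := hv.1
        have hw0 := hw.1
        simp only [hv0, hw0, ne_eq, not_false_eq_true, dif_pos] at h
        rw [Projectivization.mk_eq_mk_iff'] at h
        obtain ⟨c, rfl⟩ := h
        obtain ⟨i, hi⟩ := Function.ne_iff.1 ha0
        have h1 := hva i
        rw [bk_eval_smul (hyV i), hwa i, pow_one] at h1
        have : c = 1 := by
          have h2 : (c - 1) * a i = 0 := by rw [sub_mul, h1]; ring
          rcases mul_eq_zero.1 h2 with h3 | h3
          · exact sub_eq_zero.1 h3
          · exact absurd h3 hi
        rw [this, one_smul]
      · rintro x ⟨hx, c, hc⟩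
        have hxA := bk_rep_mem.2 hx
        have hc0 : c ≠ 0 := by
          rintro rfl
          obtain ⟨i, hi⟩ := hynz _ hxA
          exact hi (by rw [hc i, zero_mul])
        have h1 := bk_cone_smul X _ hxA c⁻¹ (inv_ne_zero hc0)
        refine ⟨c⁻¹ • x.rep, ⟨h1, fun i => ?_⟩, ?_⟩
        · rw [bk_eval_smul (hyV i), hc i]; field_simp
        · have h2 := h1.1
          simp only [h2, ne_eq, not_false_eq_true, dif_pos]
          exact bk_mk_smul x _ _
    refine hle.trans (hmax ⟨W', ?_, ?_⟩)
    · rw [← hbij.image_eq]; exact hfin.image _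
    · rw [← hbij.image_eq, hbij.injOn.ncard_image]
  · rw [← hTcard]
    refine bk_fibre_upper hA π hs hπ (le_refl 1) hy T hTA (fun i => if i = 0 then 1 else 0) fun v hv i => ?_
    split_ifs with h
    · rw [h]; exact (hyT v hv).1
    · exact (hyT v hv).2 i h

def bkAct {σ : Type} [Fintype σ] [DecidableEq σ] (h : (σ → ℂ) ≃ₗ[ℂ] (σ → ℂ)) :
    MvPolynomial σ ℂ →ₐ[ℂ] MvPolynomial σ ℂ :=
  aeval (fun i => bkLin ((LinearMap.proj i).comp (h : (σ → ℂ) →ₗ[ℂ] (σ → ℂ))))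

theorem bkAct_eval {σ : Type} [Fintype σ] [DecidableEq σ] (h : (σ → ℂ) ≃ₗ[ℂ] (σ → ℂ))
    (p : MvPolynomial σ ℂ) (v : σ → ℂ) : eval v (bkAct h p) = eval (h v) p := by
  have : (aeval v : MvPolynomial σ ℂ →ₐ[ℂ] ℂ).comp (bkAct h) = aeval (h v) := by
    ext i
    simp [bkAct, bkLin_eval]
  have := congrArg (fun φ => φ p) this
  simpa using this

theorem bkAct_hom {σ : Type} [Fintype σ] [DecidableEq σ] (h : (σ → ℂ) ≃ₗ[ℂ] (σ → ℂ))
    {p : MvPolynomial σ ℂ} {k : ℕ} (hp : p.IsHomogeneous k) : (bkAct h p).IsHomogeneous k := by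
  have := hp.aeval _ (fun i => bkLin_hom ((LinearMap.proj i).comp (h : (σ → ℂ) →ₗ[ℂ] (σ → ℂ))))
  rw [one_mul] at this
  exact this

theorem bk_card_dvd_abs (B S : Type*) [CommRing B] [IsDomain B] [CommRing S] [IsDomain S]
    [Algebra B S] [Module.Finite B S] [FaithfulSMul B S] (H : Type*) [Group H] [Finite H]
    (a : H → S →+* S) (hb : ∀ h b, a h (algebraMap B S b) = algebraMap B S b)
    (h1 : ∀ x, a 1 x = x) (hmul : ∀ h k x, a (h * k) x = a h (a k x))
    (hinj : ∀ h, (∀ x, a h x = x) → h = 1) : Nat.card H ∣ Module.finrank B S := by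
  let α : H →* (S →ₐ[B] S) :=
    { toFun := fun h => { a h with commutes' := hb h }
      map_one' := AlgHom.ext h1
      map_mul' := fun h k => AlgHom.ext (hmul h k) }
  refine bk_card_dvd B S H ((AlgEquiv.algHomUnitsEquiv B S).toMonoidHom.comp α.toHomUnits) ?_
  rw [injective_iff_map_eq_one]
  intro h hh
  exact hinj h fun x => congrArg (fun φ : S ≃ₐ[B] S => φ x) hh

theorem bk_dual_sep {σ : Type} (x w : σ → ℂ) (hx : ∀ c : ℂ, x ≠ c • w) :
    ∃ l : Module.Dual ℂ (σ → ℂ), l w = 0 ∧ l x = 1 := by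
  have : x ∉ Submodule.span ℂ {w} := fun h => by
    obtain ⟨c, hc⟩ := Submodule.mem_span_singleton.1 h
    exact hx c hc.symm
  obtain ⟨l, hl, hlw⟩ := Submodule.exists_le_ker_of_notMem this
  refine ⟨(l x)⁻¹ • l, ?_, ?_⟩
  · have : l w = 0 := hlw (Submodule.mem_span_singleton_self w)
    simp [this]
  · simp [hl]

section
variable {σ : Type} [Fintype σ] [DecidableEq σ] {A : Set (σ → ℂ)} (hA : BkCone A)
  (H : Subgroup ((σ → ℂ) ≃ₗ[ℂ] (σ → ℂ))) [Finite H]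
  (hpres : ∀ h ∈ H, ∀ v ∈ A, h v ∈ A)
  (hfree : ∀ h ∈ H, h ≠ 1 → ∀ v ∈ A, ∀ c : ℂ, h v ≠ c • v)

def bkInv (m : ℕ) : Submodule ℂ (MvPolynomial σ ℂ) where
  carrier := {p | p.IsHomogeneous m ∧ ∀ h ∈ H, ∀ v, eval (h v) p = eval v p}
  add_mem' := fun {p q} hp hq => ⟨hp.1.add hq.1, fun h hh v => by simp [hp.2 h hh, hq.2 h hh]⟩
  zero_mem' := ⟨isHomogeneous_zero _ _ _, fun h hh v => by simp⟩
  smul_mem' := fun c p hp => ⟨(homogeneousSubmodule σ ℂ m).smul_mem c hp.1, fun h hh v => by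
    simp [smul_eval, hp.2 h hh]⟩

include hA hfree in
theorem bk_inv_exists (x : σ → ℂ) (hx : x ∈ A) :
    ∃ p ∈ bkInv H (Nat.card H + 1), eval x p = 1 := by
  classical
  have := Fintype.ofFinite H
  have hx0 := hA.ne_zero x hx
  have hl : ∀ h : H, h ≠ 1 → ∃ l : Module.Dual ℂ (σ → ℂ), l (h.1 x) = 0 ∧ l x = 1 := by
    intro h h1
    refine bk_dual_sep x _ fun c hc => ?_
    have hc0 : c ≠ 0 := by rintro rfl; exact hx0 (by rw [hc, zero_smul])
    refine hfree h.1 h.2 (fun h' => h1 (Subtype.ext h')) x hx c⁻¹ ?_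
    conv_rhs => rw [hc]
    rw [smul_smul, inv_mul_cancel₀ hc0, one_smul]
  choose! l hl0 hl1 using hl
  obtain ⟨l', -, hl'⟩ := bk_dual_sep x 0 (fun c => by simpa using hx0)
  let q : MvPolynomial σ ℂ := bkLin l' ^ 2 * ∏ h ∈ Finset.univ.erase (1 : H), bkLin (l h)
  have hq : q.IsHomogeneous (Nat.card H + 1) := by
    have h1 : (∏ h ∈ Finset.univ.erase (1 : H), bkLin (l h)).IsHomogeneous
        (∑ h ∈ Finset.univ.erase (1 : H), 1) := IsHomogeneous.prod _ _ _ fun h _ => bkLin_hom _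
    have h2 := ((bkLin_hom l').pow 2).mul h1
    convert h2 using 1
    have : 0 < Fintype.card H := Fintype.card_pos
    simp [Finset.card_erase_of_mem, Nat.card_eq_fintype_card]
    omega
  refine ⟨∑ h : H, bkAct h.1 q, ⟨IsHomogeneous.sum _ _ _ fun h _ => bkAct_hom _ hq, ?_⟩, ?_⟩
  · intro k hk v
    simp only [map_sum, bkAct_eval]
    refine Fintype.sum_equiv (Equiv.mulRight ⟨k, hk⟩) _ _ fun h => ?_
    simp
  · simp only [map_sum, bkAct_eval]
    rw [Finset.sum_eq_single 1]
    · simp only [q, map_mul, map_pow, map_prod, bkLin_eval]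
      rw [Finset.prod_eq_one]
      · simp [hl']
      · intro h hh
        exact hl1 h (Finset.ne_of_mem_erase hh)
    · intro h _ h1
      simp only [q, map_mul, map_pow, map_prod, bkLin_eval]
      rw [Finset.prod_eq_zero (Finset.mem_erase.2 ⟨h1, Finset.mem_univ h⟩), mul_zero]
      exact hl0 h h1
    · simp

include hA hfree in
theorem bk_inv_sys : ∃ (t : ℕ) (g : Fin (t + 1) → MvPolynomial σ ℂ), BkSys A (Nat.card H + 1) g ∧
    ∀ i, g i ∈ bkInv H (Nat.card H + 1) := by
  have hex := bk_inv_exists hA H hfree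
  set m := Nat.card H + 1 with hm
  have hle : bkInv H m ≤ restrictTotalDegree σ ℂ m := fun p hp =>
    (mem_restrictTotalDegree _ _ _).2 hp.1.totalDegree_le
  have hfin : Module.Finite ℂ (bkInv H m) :=
    Module.Finite.of_injective (Submodule.inclusion hle) (Submodule.inclusion_injective hle)
  let bs := Module.finBasis ℂ (bkInv H m)
  obtain ⟨v0, hv0⟩ := hA.nonempty
  obtain ⟨P0, hP0, hP1⟩ := hex v0 hv0
  let f : Fin (Module.finrank ℂ (bkInv H m) + 1) → MvPolynomial σ ℂ :=
    Fin.cons P0 (fun j => (bs j : MvPolynomial σ ℂ) - (eval v0 (bs j : MvPolynomial σ ℂ)) • P0)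
  obtain ⟨t, g, hgV, hgnz, -, hgind⟩ := bk_norm hA (m := m) (by omega) (bkInv H m) (fun p hp => hp.1)
    {v0} (by simpa using hv0) ⟨v0, rfl⟩ _ f (fun i => by
      refine Fin.cases ?_ (fun j => ?_) i
      · exact hP0
      · exact Submodule.sub_mem _ (bs j).2 (Submodule.smul_mem _ _ hP0)) (fun v hv => by
      by_contra hcon
      push Not at hcon
      have h0 : eval v P0 = 0 := by simpa [f] using hcon 0
      have h1 : ∀ j, eval v (bs j : MvPolynomial σ ℂ) = 0 := fun j => by
        simpa [f, smul_eval, h0] using hcon j.succ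
      obtain ⟨p, hp, hp1⟩ := hex v hv
      have h2 := bs.sum_repr ⟨p, hp⟩
      have h3 := congrArg (fun z : bkInv H m => eval v (z : MvPolynomial σ ℂ)) h2
      simp only at h3
      rw [hp1, Submodule.coe_sum, map_sum] at h3
      refine one_ne_zero (h3.symm.trans (Finset.sum_eq_zero fun j _ => ?_))
      simp [smul_eval, h1 j]) (fun v hv => by
      rw [Set.mem_singleton_iff] at hv
      subst hv
      refine ⟨by simpa [f] using hP1, fun j => ?_⟩
      refine Fin.cases (fun h => absurd rfl h) (fun j _ => ?_) j
      simp [f, smul_eval, hP1])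
  exact ⟨t, g, ⟨fun i => (hgV i).1, hgnz, hgind⟩, hgV⟩

include hA hfree hpres in
set_option maxHeartbeats 1000000 in
theorem bk_card_dvd_inv {S : Type} [CommRing S] [IsDomain S] [Algebra ℂ S]
    (π : MvPolynomial σ ℂ →ₐ[ℂ] S) (hs : Function.Surjective π)
    (hπ : ∀ p, π p = 0 ↔ ∀ v ∈ A, eval v p = 0) {m t : ℕ} (hm : 1 ≤ m)
    {g : Fin (t + 1) → MvPolynomial σ ℂ} (hg : BkSys A m g) (hgV : ∀ i, g i ∈ bkInv H m) :
    Nat.card H ∣ bkD (fun i => π (g i)) := by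
  let _ := bkAlg (fun i => π (g i))
  have h1 := bkAlg_faithful π hπ hg
  have h2 := bk_finite hA π hs hπ hm g hg.hom hg.nz (fun b => rfl)
  have hex : ∀ h : H, ∃ a : S →ₐ[ℂ] S, ∀ p, a (π p) = π (bkAct h⁻¹.1 p) := by
    intro h
    refine ⟨AlgHom.liftOfSurjective π hs (π.comp (bkAct h⁻¹.1)) ?_, fun p => ?_⟩
    · intro p hp
      change π (bkAct h⁻¹.1 p) = 0
      rw [hπ]
      intro v hv
      rw [bkAct_eval]
      exact (hπ p).1 hp _ (hpres _ h⁻¹.2 v hv)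
    · rw [AlgHom.liftOfSurjective_apply]; rfl
  choose a ha using hex
  have hag : ∀ h (b : MvPolynomial (Fin (t + 1)) ℂ), a h (algebraMap _ S b) = algebraMap _ S b := by
    intro h b
    have : (a h).comp (aeval (fun i => π (g i)) : MvPolynomial (Fin (t + 1)) ℂ →ₐ[ℂ] S) = aeval (fun i => π (g i)) := by
      ext i
      simp only [AlgHom.comp_apply, aeval_X, ha]
      refine congrArg π ?_
      refine MvPolynomial.funext fun v => ?_
      rw [bkAct_eval, (hgV i).2 _ h⁻¹.2]
    exact congrArg (fun φ => φ b) this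
  refine bk_card_dvd_abs (MvPolynomial (Fin (t + 1)) ℂ) S H (fun h => (a h : S →+* S)) hag ?_ ?_ ?_
  · intro x
    obtain ⟨p, rfl⟩ := hs x
    change a 1 (π p) = π p
    rw [ha]
    refine congrArg π ?_
    refine MvPolynomial.funext fun v => ?_
    rw [bkAct_eval]; simp
  · intro h k x
    obtain ⟨p, rfl⟩ := hs x
    change a (h * k) (π p) = a h (a k (π p))
    rw [ha, ha, ha]
    refine congrArg π ?_
    refine MvPolynomial.funext fun v => ?_
    rw [bkAct_eval, bkAct_eval, bkAct_eval]; simp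
  intro h hh
  have h3 : ∀ p, a h (π p) = π p := fun p => hh (π p)
  by_contra hne
  obtain ⟨v, hv⟩ := hA.nonempty
  refine hfree h⁻¹.1 h⁻¹.2 (fun h' => hne (inv_eq_one.1 (Subtype.ext h'))) v hv 1 ?_
  rw [one_smul]
  funext i
  have h4 := h3 (X i)
  rw [ha, ← sub_eq_zero, ← map_sub, hπ] at h4
  have := h4 v hv
  rw [map_sub, bkAct_eval, eval_X, eval_X, sub_eq_zero] at this
  exact this
end

theorem bk_linear_dvd {n : ℕ} (X : Set (Pn n)) (hX : IsProjectiveVariety n X) (hne : X.Nonempty)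
    (d : ℕ) (hd : IsDegree n X d) (H : Subgroup (GLn n)) [Finite H]
    (hpres : ∀ h ∈ H, ∀ v ∈ cone n X, h v ∈ cone n X)
    (hfree : ∀ h ∈ H, h ≠ 1 → ∀ v ∈ cone n X, ∀ c : ℂ, h v ≠ c • v) : Nat.card H ∣ d := by
  obtain ⟨I, hI, hIp⟩ : ∃ I : Ideal (MvPolynomial (Fin (n + 1)) ℂ),
      (∀ p, p ∈ I ↔ ∀ v ∈ cone n X, eval v p = 0) ∧ I.IsPrime :=
    ⟨_, fun p => Iff.rfl, hX.2⟩
  have hA := bk_isCone X hX hne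
  let π : MvPolynomial (Fin (n + 1)) ℂ →ₐ[ℂ] (MvPolynomial (Fin (n + 1)) ℂ ⧸ I) :=
    Ideal.Quotient.mkₐ ℂ I
  have hs : Function.Surjective π := Ideal.Quotient.mk_surjective
  have hπ : ∀ p, π p = 0 ↔ ∀ v ∈ cone n X, eval v p = 0 := fun p =>
    Ideal.Quotient.eq_zero_iff_mem.trans (hI p)
  have hdom : IsDomain (MvPolynomial (Fin (n + 1)) ℂ ⧸ I) := Ideal.Quotient.isDomain I
  obtain ⟨s, y, hy, hyd⟩ := bk_degree X hX hne d hd π hs hπ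
  obtain ⟨t, g, hg, hgV⟩ := bk_inv_sys hA H hfree
  have h1 := bk_card_dvd_inv hA H hpres hfree π hs hπ (by omega) hg hgV
  rw [bk_ratio hA π hs hπ (by omega) hg hy, hyd] at h1
  refine Nat.Coprime.dvd_of_dvd_mul_right ?_ h1
  apply Nat.Coprime.pow_right
  simp

theorem bk_lift_group (p : ℕ) [Fact p.Prime] (Γ : Type) [Group Γ]
    (hdiv : ∀ z ∈ Subgroup.center Γ, ∃ w ∈ Subgroup.center Γ, w ^ p = z)
    (htor : {z : Γ | z ∈ Subgroup.center Γ ∧ z ^ p = 1}.Finite ∧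
      {z : Γ | z ∈ Subgroup.center Γ ∧ z ^ p = 1}.ncard ≤ p)
    (k : ℕ) (Q : Subgroup (Γ ⧸ Subgroup.center Γ)) (hQ : Nat.card Q = p ^ k) :
    ∃ H : Subgroup Γ, Finite H ∧ (∀ h ∈ H, (QuotientGroup.mk h : Γ ⧸ Subgroup.center Γ) ∈ Q) ∧
      (∀ h ∈ H, (QuotientGroup.mk h : Γ ⧸ Subgroup.center Γ) = 1 → h = 1) ∧
      p ^ k ≤ (Nat.card H) ^ 2 ∧ Nat.card H ∣ p ^ k := by
  let f := QuotientGroup.mk' (Subgroup.center Γ)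
  have hf : Function.Surjective f := QuotientGroup.mk'_surjective _
  let E : Subgroup Γ := Q.comap f
  let Z : Subgroup E := (Subgroup.center Γ).subgroupOf E
  have hCE : Subgroup.center Γ ≤ E := fun z hz => by
    have : f z = 1 := (QuotientGroup.eq_one_iff z).2 hz
    change f z ∈ Q
    rw [this]; exact Q.one_mem
  have himg : Subtype.val '' {z : E | z ∈ Z ∧ z ^ p = 1} =
      {z : Γ | z ∈ Subgroup.center Γ ∧ z ^ p = 1} := by
    ext z
    constructor
    · rintro ⟨w, ⟨hw, hw1⟩, rfl⟩
      exact ⟨hw, by simpa using congrArg Subtype.val hw1⟩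
    · rintro ⟨hz, hz1⟩
      exact ⟨⟨z, hCE hz⟩, ⟨hz, Subtype.ext hz1⟩, rfl⟩
  have hz1 : Z ≤ Subgroup.center E := by
    intro z hz
    rw [Subgroup.mem_center_iff]
    intro g
    exact Subtype.ext (Subgroup.mem_center_iff.1 hz g.1)
  have hz2 : ∀ z ∈ Z, ∃ w ∈ Z, w ^ p = z := by
    intro z hz
    obtain ⟨w, hw, hwz⟩ := hdiv z.1 hz
    exact ⟨⟨w, hCE hw⟩, hw, Subtype.ext hwz⟩
  have hz3 : {z : E | z ∈ Z ∧ z ^ p = 1}.Finite ∧ {z : E | z ∈ Z ∧ z ^ p = 1}.ncard ≤ p := by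
    constructor
    · refine Set.Finite.of_finite_image ?_ Subtype.val_injective.injOn
      rw [himg]; exact htor.1
    · rw [← Set.ncard_image_of_injective _ Subtype.val_injective, himg]
      exact htor.2
  have hz4 : Z.index = p ^ k := by
    change (Subgroup.center Γ).relIndex E = _
    have h1 : f.ker = Subgroup.center Γ := QuotientGroup.ker_mk' _
    rw [← h1, Subgroup.relIndex_ker, Subgroup.map_comap_eq_self_of_surjective hf, hQ]
  obtain ⟨H, hHZ, hHf, hHk⟩ := bk_group_part p k E Z hz1 hz2 hz3 hz4
  · have hone : ∀ h ∈ H, f h.1 = 1 → h = 1 := fun h hh h1 => by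
      have : h ∈ H ⊓ Z := ⟨hh, (QuotientGroup.eq_one_iff h.1).1 h1⟩
      rwa [hHZ, Subgroup.mem_bot] at this
    have hcard : Nat.card (H.map E.subtype) = Nat.card H :=
      (Nat.card_congr (H.equivMapOfInjective E.subtype E.subtype_injective).toEquiv).symm
    refine ⟨H.map E.subtype, ?_, ?_, ?_, ?_, ?_⟩
    · exact Finite.of_equiv H (H.equivMapOfInjective E.subtype E.subtype_injective).toEquiv
    · rintro _ ⟨h, hh, rfl⟩
      exact h.2
    · rintro _ ⟨h, hh, rfl⟩ h1
      rw [hone h hh h1]; rfl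
    · rwa [hcard]
    · rw [hcard, ← hQ]
      let φ : H →* Q := ((f.comp E.subtype).comp H.subtype).codRestrict Q (fun h => h.1.2)
      refine Subgroup.card_dvd_of_injective φ ?_
      rw [injective_iff_map_eq_one]
      intro h hh
      exact Subtype.ext (hone h.1 h.2 (congrArg Subtype.val hh))

theorem bk_center_scalar {σ : Type} [Fintype σ] (g : (σ → ℂ) ≃ₗ[ℂ] (σ → ℂ))
    (hg : g ∈ Subgroup.center ((σ → ℂ) ≃ₗ[ℂ] (σ → ℂ))) : ∃ a : ℂ, ∀ v, g v = a • v := by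
  obtain ⟨a, ha⟩ := LinearMap.exists_eq_smul_id_of_forall_notLinearIndependent
    (f := (g : (σ → ℂ) →ₗ[ℂ] (σ → ℂ))) (fun v hli => by
      have hv : v ≠ 0 := hli.ne_zero 0
      obtain ⟨l, hl0, hl1⟩ := bk_dual_sep (g v) v (fun c hc => by
        rw [LinearIndependent.pair_iff] at hli
        have := hli c (-1) (by simp [hc])
        simp at this)
      have h1 := Subgroup.mem_center_iff.1 hg (LinearEquiv.transvection hl0)
      have h2 := congrArg (fun φ : (σ → ℂ) ≃ₗ[ℂ] (σ → ℂ) => φ v) h1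
      simp [LinearEquiv.mul_apply, LinearMap.transvection.apply, hl0, hl1] at h2
      exact hv h2)
  exact ⟨a, fun v => by simpa using congrArg (fun φ : (σ → ℂ) →ₗ[ℂ] (σ → ℂ) => φ v) ha⟩

theorem bk_scalar_center {σ : Type} (a : ℂ) (ha : a ≠ 0) :
    ∃ g ∈ Subgroup.center ((σ → ℂ) ≃ₗ[ℂ] (σ → ℂ)), ∀ v, g v = a • v :=
  ⟨LinearEquiv.smulOfNeZero ℂ (σ → ℂ) a ha, Subgroup.mem_center_iff.2 fun g => by
    ext1 v; simp [LinearEquiv.mul_apply], fun v => by simp⟩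

theorem bk_pow_scalar {σ : Type} (g : (σ → ℂ) ≃ₗ[ℂ] (σ → ℂ)) (a : ℂ) (h : ∀ v, g v = a • v)
    (p : ℕ) (v : σ → ℂ) : (g ^ p) v = a ^ p • v := by
  induction p with
  | zero => simp
  | succ p ih => rw [pow_succ', LinearEquiv.mul_apply, ih, h, smul_smul, ← pow_succ']

theorem bk_center_div (n p : ℕ) [Fact p.Prime] :
    ∀ z ∈ Subgroup.center (GLn n), ∃ w ∈ Subgroup.center (GLn n), w ^ p = z := by
  intro z hz
  obtain ⟨a, ha⟩ := bk_center_scalar z hz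
  have hp := (Fact.out : p.Prime).pos
  obtain ⟨b, hb⟩ := IsAlgClosed.exists_pow_nat_eq a hp
  have ha0 : a ≠ 0 := by
    rintro rfl
    have h1 := ha 1
    rw [zero_smul] at h1
    have h2 := z.map_eq_zero_iff.1 h1
    exact one_ne_zero h2
  have hb0 : b ≠ 0 := by rintro rfl; exact ha0 (by rw [← hb, zero_pow hp.ne'])
  obtain ⟨w, hw, hwb⟩ := bk_scalar_center (σ := Fin (n + 1)) b hb0
  refine ⟨w, hw, ?_⟩
  ext1 v
  rw [bk_pow_scalar w b hwb, ha, hb]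

theorem bk_center_tor (n p : ℕ) [Fact p.Prime] :
    {z : GLn n | z ∈ Subgroup.center (GLn n) ∧ z ^ p = 1}.Finite ∧
      {z : GLn n | z ∈ Subgroup.center (GLn n) ∧ z ^ p = 1}.ncard ≤ p := by
  classical
  have hp := (Fact.out : p.Prime).pos
  let F : Finset ℂ := (Polynomial.nthRoots p (1 : ℂ)).toFinset
  have hF : F.card ≤ p := (Multiset.toFinset_card_le _).trans (Polynomial.card_nthRoots p 1)
  have hmaps : Set.MapsTo (fun z : GLn n => z 1 0)
      {z : GLn n | z ∈ Subgroup.center (GLn n) ∧ z ^ p = 1} (F : Set ℂ) := by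
    rintro z ⟨hz, hzp⟩
    obtain ⟨a, ha⟩ := bk_center_scalar z hz
    have h1 := bk_pow_scalar z a ha p 1
    rw [hzp] at h1
    have h2 := congrFun h1 0
    simp at h2
    simp [F, Polynomial.mem_nthRoots hp, ha, ← h2]
  have hinj : Set.InjOn (fun z : GLn n => z 1 0)
      {z : GLn n | z ∈ Subgroup.center (GLn n) ∧ z ^ p = 1} := by
    rintro z ⟨hz, -⟩ w ⟨hw, -⟩ hzw
    obtain ⟨a, ha⟩ := bk_center_scalar z hz
    obtain ⟨b, hb⟩ := bk_center_scalar w hw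
    have : a = b := by simpa [ha, hb] using hzw
    ext1 v
    rw [ha, hb, this]
  refine ⟨Set.Finite.of_injOn hmaps hinj F.finite_toSet, ?_⟩
  have := Set.ncard_le_ncard_of_injOn _ (fun a ha => hmaps ha) hinj F.finite_toSet
  rw [Set.ncard_coe_finset] at this
  exact this.trans hF

theorem bk_prime_part {n : ℕ}
    (X : Set (Pn n)) (hX : IsProjectiveVariety n X) (hXne : X.Nonempty)
    (d : ℕ) (hd : IsDegree n X d)
    (G : Subgroup (PGLn n)) [Finite G]
    (hpres : ∀ g : GLn n, (QuotientGroup.mk g : PGLn n) ∈ G →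
      ∀ v ∈ cone n X, g v ∈ cone n X)
    (hfree : ∀ g : GLn n, (QuotientGroup.mk g : PGLn n) ∈ G →
      (QuotientGroup.mk g : PGLn n) ≠ 1 →
      ∀ v ∈ cone n X, ¬ ∃ c : ℂ, g v = c • v) (p k : ℕ) (hp : p.Prime) (hk : p ^ k ∣ Nat.card G) :
    p ^ k ∣ d ^ 2 := by
  have : Fact p.Prime := ⟨hp⟩
  obtain ⟨P, hP⟩ := Sylow.exists_subgroup_card_pow_prime p hk
  have hQ : Nat.card (P.map G.subtype) = p ^ k := by
    rw [← hP]
    exact (Nat.card_congr (P.equivMapOfInjective G.subtype G.subtype_injective).toEquiv).symm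
  obtain ⟨H, hHf, hHQ, hH1, hHk, hHd⟩ := bk_lift_group p (GLn n) (bk_center_div n p)
    (bk_center_tor n p) k _ hQ
  have hHG : ∀ h ∈ H, (QuotientGroup.mk h : PGLn n) ∈ G := fun h hh => by
    obtain ⟨x, -, hx⟩ := hHQ h hh
    rw [← hx]; exact x.2
  have hdvd := bk_linear_dvd X hX hXne d hd H (fun h hh => hpres h (hHG h hh))
    (fun h hh h1 v hv c hc => hfree h (hHG h hh) (fun h2 => h1 (hH1 h hh h2)) v hv ⟨c, hc⟩)
  obtain ⟨j, -, hj⟩ := (Nat.dvd_prime_pow hp).1 hHd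
  refine dvd_trans ?_ (pow_dvd_pow_of_dvd hdvd 2)
  rw [hj, ← pow_mul] at hHk ⊢
  exact pow_dvd_pow p ((Nat.pow_le_pow_iff_right hp.one_lt).1 hHk)

theorem bk_final (n : ℕ)
    (X : Set (Pn n)) (hX : IsProjectiveVariety n X) (hXne : X.Nonempty)
    (d : ℕ) (hd : IsDegree n X d)
    (G : Subgroup (PGLn n)) [Finite G]
    (hpres : ∀ g : GLn n, (QuotientGroup.mk g : PGLn n) ∈ G →
      ∀ v ∈ cone n X, g v ∈ cone n X)
    (hfree : ∀ g : GLn n, (QuotientGroup.mk g : PGLn n) ∈ G →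
      (QuotientGroup.mk g : PGLn n) ≠ 1 →
      ∀ v ∈ cone n X, ¬ ∃ c : ℂ, g v = c • v) :
    Nat.card G ∣ d ^ 2 :=
  (Nat.dvd_iff_prime_pow_dvd_dvd _ _).2 fun p k hp hk =>
    bk_prime_part X hX hXne d hd G hpres hfree p k hp hk

/-- **Browder–Katz.** If `X ⊆ ℙⁿ` is a projective variety of degree `d` and
`G ⊆ PGL(n+1, ℂ)` is a finite group preserving `X` and acting freely on `X`, then
`|G|` divides `d²`. -/
theorem card_dvd_degree_sq_of_free_action
    (X : Set (Pn n)) (hX : IsProjectiveVariety n X) (hXne : X.Nonempty)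
    (d : ℕ) (hd : IsDegree n X d)
    (G : Subgroup (PGLn n)) [Finite G]
    (hpres : ∀ g : GLn n, (QuotientGroup.mk g : PGLn n) ∈ G →
      ∀ v ∈ cone n X, g v ∈ cone n X)
    (hfree : ∀ g : GLn n, (QuotientGroup.mk g : PGLn n) ∈ G →
      (QuotientGroup.mk g : PGLn n) ≠ 1 →
      ∀ v ∈ cone n X, ¬ ∃ c : ℂ, g v = c • v) :
    Nat.card G ∣ d ^ 2 := by
  exact bk_final n X hX hXne d hd G hpres hfree

end
end
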